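/- arXiv:1809.09781 — 5 statements merged into one kernel-verified Lean document; each statement's English description precedes it below -/
import Mathlib

section
/- Let 𝓗 be a complex Hilbert space, U : ℝ → U(𝓗) a strongly continuous one-parameter unitary group, and A ⊆ B(𝓗) a C*-subalgebra with U_t A U_t⁻¹ = A for all t. Let 𝓗⁺ be the orthogonal complement in 𝓗 of the closed linear span of {Lψ : L ∈ 𝔏₋, ψ ∈ 𝓗}, and let P be the orthogonal projection onto 𝓗⁺ (𝓗⁺ is the non-negative spectral subspace of U). Then: (a) U_t 𝓗⁺ = 𝓗⁺ for all t, so U restricts to a strongly continuous one-parameter unitary group U⁺ on 𝓗⁺, and U⁺ has non-negative spectrum; (b) O := {a ∈ A : aP = Pa} is a C*-subalgebra of A with U_t O U_t⁻¹ = O for all t, and A⁺ := {the restriction of P a P to 𝓗⁺ : a ∈ O} is a C*-subalgebra of B(𝓗⁺) with U⁺_t A⁺ (U⁺_t)⁻¹ = A⁺; (c) if moreover A·𝔏_U ⊆ closed linear span of 𝔏_U·B(𝓗) (i.e. (A,U) is a cross representation), then A⁺·𝔏_{U⁺} ⊆ closed linear span of 𝔏_{U⁺}·B(𝓗⁺)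 (i.e. (A⁺,U⁺) is a positive cross representation). -/
open MeasureTheory Filter

noncomputable section

variable {H : Type*} [NormedAddCommGroup H] [InnerProductSpace ℂ H] [CompleteSpace H]

/-- The norm-closed *-subalgebra of `B(H)` generated by the integrated operators
`U(f) : ψ ↦ ∫ f(g) U_g ψ dμ(g)`, for `f ∈ L¹(G,μ)`. -/
def integratedAlgebra {G : Type*} [MeasurableSpace G] (μ : Measure G)
    (U : G → H →L[ℂ] H) : Set (H →L[ℂ] H) :=
  closure (↑(NonUnitalStarAlgebra.adjoin ℂ
    {T : H →L[ℂ] H | ∃ f : G → ℂ, Integrable f μ ∧ ∀ ψ : H, T ψ = ∫ g, f g • U g ψ ∂μ}) :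
    Set (H →L[ℂ] H))

/-- The closed linear span of `S · B(H)`. -/
def closedRightSpan (S : Set (H →L[ℂ] H)) : Set (H →L[ℂ] H) :=
  closure (↑(Submodule.span ℂ
    {x : H →L[ℂ] H | ∃ L ∈ S, ∃ B : H →L[ℂ] H, x = L * B}) : Set (H →L[ℂ] H))

/-- `(A, S)` is a cross representation: `A·S ⊆ closed span (S·B(H))`. -/
def IsCrossRep (A S : Set (H →L[ℂ] H)) : Prop :=
  ∀ a ∈ A, ∀ L ∈ S, a * L ∈ closedRightSpan S

/-- A strongly continuous unitary representation of a topological group. -/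
def IsUnitaryRep {G : Type*} [Group G] [TopologicalSpace G] (U : G → H →L[ℂ] H) : Prop :=
  (∀ g, U g ∈ unitary (H →L[ℂ] H)) ∧ (∀ g h, U (g * h) = U g * U h) ∧
    ∀ ψ : H, Continuous fun g => U g ψ

/-- A strongly continuous one-parameter unitary group. -/
def IsUnitaryOneParam (U : ℝ → H →L[ℂ] H) : Prop :=
  (∀ t, U t ∈ unitary (H →L[ℂ] H)) ∧ (∀ s t, U (s + t) = U s * U t) ∧
    ∀ ψ : H, Continuous fun t => U t ψ


/-- `f ∈ L¹(ℝ)` whose Fourier transform `λ ↦ ∫ f(t)e^{itλ} dt` vanishes for all `λ ≥ 0`. -/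
def NegSpectralFun (f : ℝ → ℂ) : Prop :=
  Integrable f ∧ ∀ l : ℝ, 0 ≤ l →
    (∫ t : ℝ, f t * Complex.exp (Complex.I * (t : ℂ) * (l : ℂ))) = 0

/-- `𝔏₋`: the closed linear span of `{U(f) : f ∈ L¹(ℝ), f̂ vanishes on [0,∞)}`
(the image of the ideal `C₀((−∞,0))` of `C*(ℝ)`). -/
def negPartAlgebra (U : ℝ → H →L[ℂ] H) : Set (H →L[ℂ] H) :=
  closure (↑(Submodule.span ℂ
    {T : H →L[ℂ] H | ∃ f : ℝ → ℂ, NegSpectralFun f ∧ ∀ ψ : H, T ψ = ∫ t, f t • U t ψ}) :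
    Set (H →L[ℂ] H))

/-- A one-parameter unitary group has non-negative spectrum if `U(f) = 0` for every
`f ∈ L¹(ℝ)` whose Fourier transform vanishes on `[0,∞)`. -/
def HasNonnegSpectrum (U : ℝ → H →L[ℂ] H) : Prop :=
  ∀ f : ℝ → ℂ, NegSpectralFun f → ∀ ψ : H, (∫ t, f t • U t ψ) = 0


lemma aux_sa_lift {A B : Type*} [NonUnitalCStarAlgebra A] [NonUnitalCStarAlgebra B]
    (φ : A →⋆ₙₐ[ℂ] B) (hφ : Continuous φ) (a : A) (ha : IsSelfAdjoint a) :
    ∃ a' : A, φ a' = φ a ∧ ‖a'‖ ≤ ‖φ a‖ := by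
  set r := ‖φ a‖ with hr
  have hr0 : 0 ≤ r := norm_nonneg _
  let f : ℝ → ℝ := fun x => max (min x r) (-r)
  have hf : Continuous f := by fun_prop
  have hf0 : f 0 = 0 := by simp [f, hr0]
  have hφa : IsSelfAdjoint (φ a) := ha.map φ
  refine ⟨cfcₙ f a, ?_, ?_⟩
  · rw [φ.map_cfcₙ f a hf.continuousOn hf0 hφ ha hφa]
    conv_rhs => rw [← cfcₙ_id' ℝ (φ a)]
    apply cfcₙ_congr
    intro x hx
    have h1 := norm_apply_le_norm_cfcₙ (fun x : ℝ => x) (φ a) hx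
    rw [cfcₙ_id' ℝ (φ a), Real.norm_eq_abs, abs_le] at h1
    simp only [f]
    rw [min_eq_left h1.2, max_eq_left h1.1]
  · apply norm_cfcₙ_le
    intro x hx
    rw [Real.norm_eq_abs, abs_le]
    simp only [f]
    exact ⟨le_max_right _ _, max_le (min_le_right _ _) (by linarith)⟩

lemma aux_closed_range {A B : Type*} [NonUnitalCStarAlgebra A] [NonUnitalCStarAlgebra B]
    (φ : A →⋆ₙₐ[ℂ] B) (hφ : Continuous φ) : IsClosed (Set.range φ) := by
  let L : A →L[ℂ] B := ⟨⟨⟨φ, map_add φ⟩, map_smul φ⟩, hφ⟩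
  let f : NormedAddGroupHom A B := AddMonoidHom.mkNormedAddGroupHom
    (φ : A →+ B) ‖L‖ (fun x => L.le_opNorm x)
  have hf : ∀ x, f x = φ x := fun x => rfl
  have key : f.SurjectiveOnWith f.range 2 := by
    rintro _ ⟨a, rfl⟩
    obtain ⟨x, hx, hxn⟩ := aux_sa_lift φ hφ (realPart a : A) (realPart a).2
    obtain ⟨y, hy, hyn⟩ := aux_sa_lift φ hφ (imaginaryPart a : A) (imaginaryPart a).2
    have e1 : φ (realPart a : A) = (realPart (φ a) : B) := by
      simp only [realPart_apply_coe]
      rw [← Complex.coe_smul, ← Complex.coe_smul, map_smul, map_add, map_star]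
    have e2 : φ (imaginaryPart a : A) = (imaginaryPart (φ a) : B) := by
      simp only [imaginaryPart_apply_coe]
      rw [← Complex.coe_smul, ← Complex.coe_smul, map_smul, map_smul, map_sub, map_star]
    refine ⟨x + Complex.I • y, ?_, ?_⟩
    · change φ _ = φ a
      conv_rhs => rw [← realPart_add_I_smul_imaginaryPart a]
      simp [hx, hy]
    · change _ ≤ 2 * ‖φ a‖
      have h1 : ‖φ (realPart a : A)‖ ≤ ‖φ a‖ := by
        rw [e1]; simpa using! realPart.norm_le (φ a)
      have h2 : ‖φ (imaginaryPart a : A)‖ ≤ ‖φ a‖ := by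
        rw [e2]; simpa using! imaginaryPart.norm_le (φ a)
      calc _ ≤ ‖x‖ + ‖Complex.I • y‖ := norm_add_le _ _
        _ = ‖x‖ + ‖y‖ := by simp [norm_smul]
        _ ≤ _ := by linarith
  have := controlled_closure_of_complete (ε := 1) (by norm_num) (by norm_num) key
  have hr : Set.range φ = (f.range : Set B) := by
    ext b; simp [NormedAddGroupHom.mem_range, hf]
  rw [hr]
  refine isClosed_of_closure_subset ?_
  intro b hb
  obtain ⟨g, hg, -⟩ := this b hb
  exact ⟨g, hg⟩

/-! ### Integrated operators -/

lemma aux_U_zero {U : ℝ → H →L[ℂ] H} (hU : IsUnitaryOneParam U) : U 0 = 1 := by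
  have h := hU.2.1 0 0
  rw [add_zero] at h
  have h2 := (Unitary.mem_iff.1 (hU.1 0)).1
  calc U 0 = star (U 0) * U 0 * U 0 := by rw [h2, one_mul]
    _ = star (U 0) * U 0 := by rw [mul_assoc, ← h]
    _ = 1 := h2

lemma aux_U_neg {U : ℝ → H →L[ℂ] H} (hU : IsUnitaryOneParam U) (t : ℝ) :
    U (-t) = star (U t) := by
  have h := hU.2.1 t (-t)
  rw [add_neg_cancel, aux_U_zero hU] at h
  have h2 := (Unitary.mem_iff.1 (hU.1 t)).1
  calc U (-t) = star (U t) * U t * U (-t) := by rw [h2, one_mul]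
    _ = star (U t) := by rw [mul_assoc, ← h, mul_one]

lemma aux_norm_U {U : ℝ → H →L[ℂ] H} (hU : IsUnitaryOneParam U) (t : ℝ) (ψ : H) :
    ‖U t ψ‖ ≤ ‖ψ‖ := by
  have h1 : ‖U t‖ ≤ 1 := ContinuousLinearMap.opNorm_le_bound _ zero_le_one fun x => by
    rw [one_mul, ContinuousLinearMap.norm_map_of_mem_unitary (hU.1 t)]
  calc _ ≤ ‖U t‖ * ‖ψ‖ := (U t).le_opNorm ψ
    _ ≤ 1 * ‖ψ‖ := by gcongr
    _ = _ := one_mul _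

lemma aux_integrable {U : ℝ → H →L[ℂ] H} (hU : IsUnitaryOneParam U) {f : ℝ → ℂ}
    (hf : Integrable f) (ψ : H) : Integrable (fun t => f t • U t ψ) := by
  refine Integrable.mono' (hf.norm.mul_const ‖ψ‖)
    (hf.1.smul (hU.2.2 ψ).aestronglyMeasurable) (Eventually.of_forall fun t => ?_)
  rw [norm_smul]
  gcongr
  exact aux_norm_U hU t ψ

lemma aux_exists_op {U : ℝ → H →L[ℂ] H} (hU : IsUnitaryOneParam U) {f : ℝ → ℂ}
    (hf : Integrable f) : ∃ T : H →L[ℂ] H, ∀ ψ, T ψ = ∫ t, f t • U t ψ := by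
  let T : H →ₗ[ℂ] H :=
    { toFun := fun ψ => ∫ t, f t • U t ψ
      map_add' := fun x y => by
        rw [← integral_add (aux_integrable hU hf x) (aux_integrable hU hf y)]
        simp
      map_smul' := fun c x => by
        rw [RingHom.id_apply, ← integral_smul]
        congr 1; ext t
        rw [map_smul, smul_comm] }
  refine ⟨T.mkContinuous (∫ t, ‖f t‖) fun ψ => ?_, fun ψ => rfl⟩
  change ‖∫ t, f t • U t ψ‖ ≤ _
  rw [← integral_mul_const]
  refine norm_integral_le_of_norm_le (hf.norm.mul_const _) (Eventually.of_forall fun t => ?_)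
  rw [norm_smul]
  gcongr
  exact aux_norm_U hU t ψ

lemma aux_commute_op {U : ℝ → H →L[ℂ] H} (hU : IsUnitaryOneParam U) {f : ℝ → ℂ}
    (hf : Integrable f) {T Q : H →L[ℂ] H} (hT : ∀ ψ, T ψ = ∫ t, f t • U t ψ)
    (hQ : ∀ t, U t * Q = Q * U t) : T * Q = Q * T := by
  ext ψ
  change T (Q ψ) = Q (T ψ)
  rw [hT, hT, ← Q.integral_comp_comm (aux_integrable hU hf ψ)]
  congr 1; ext t
  rw [map_smul]
  congr 1
  exact DFunLike.congr_fun (hQ t) ψ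

/-! ### Compression to a subspace -/

/-- Compression of an operator to a complete subspace. -/
def compr {K : Type*} [NormedAddCommGroup K] [InnerProductSpace ℂ K]
    [CompleteSpace K] (V : K →ₗᵢ[ℂ] H) (T : H →L[ℂ] H) : K →L[ℂ] K :=
  (ContinuousLinearMap.adjoint V.toContinuousLinearMap) ∘L T ∘L V.toContinuousLinearMap

section Compr

variable {K : Type*} [NormedAddCommGroup K] [InnerProductSpace ℂ K] [CompleteSpace K]
  {V : K →ₗᵢ[ℂ] H} {P : H →L[ℂ] H}

/-- `P` is the orthogonal projection to `K`. -/
def ProjTo (V : K →ₗᵢ[ℂ] H) (P : H →L[ℂ] H) : Prop :=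
  (∀ v : K, P (V v) = V v) ∧ (∀ ψ, ∃ v, V v = P ψ)

lemma adj_of_mem (x : K) : ContinuousLinearMap.adjoint V.toContinuousLinearMap (V x) = x := by
  refine ext_inner_right ℂ fun w => ?_
  rw [ContinuousLinearMap.adjoint_inner_left]
  exact V.inner_map_map x w

lemma mem_of_comm (hP : ProjTo V P) {T : H →L[ℂ] H} (hT : T * P = P * T) (v : K) :
    ∃ w, V w = T (V v) := by
  have h : T (P (V v)) = P (T (V v)) := DFunLike.congr_fun hT (V v)
  rw [hP.1 v] at h
  rw [h]
  exact hP.2 _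

lemma compr_coe (hP : ProjTo V P) {T : H →L[ℂ] H} (hT : T * P = P * T) (v : K) :
    V (compr V T v) = T (V v) := by
  obtain ⟨w, hw⟩ := mem_of_comm hP hT v
  change V (ContinuousLinearMap.adjoint V.toContinuousLinearMap (T (V v))) = _
  rw [← hw, adj_of_mem]

lemma compr_eq_iff (hP : ProjTo V P) {T : H →L[ℂ] H} (hT : T * P = P * T) (S : K →L[ℂ] K) :
    S = compr V T ↔ ∀ v : K, V (S v) = T (V v) := by
  constructor
  · rintro rfl v
    exact compr_coe hP hT v
  · intro h
    ext v
    apply V.injective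
    rw [h, compr_coe hP hT]

lemma compr_star (T : H →L[ℂ] H) : compr V (star T) = star (compr V T) := by
  simp only [compr, ContinuousLinearMap.star_eq_adjoint, ContinuousLinearMap.adjoint_comp,
    ContinuousLinearMap.adjoint_adjoint]
  rfl

lemma compr_add (S T : H →L[ℂ] H) : compr V (S + T) = compr V S + compr V T := by
  simp [compr, ContinuousLinearMap.add_comp, ContinuousLinearMap.comp_add]

lemma compr_zero : compr V (0 : H →L[ℂ] H) = 0 := by
  simp [compr]

lemma compr_smul (c : ℂ) (T : H →L[ℂ] H) : compr V (c • T) = c • compr V T := by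
  simp [compr]

lemma compr_mul (hP : ProjTo V P) (S : H →L[ℂ] H) {T : H →L[ℂ] H} (hT : T * P = P * T) :
    compr V (S * T) = compr V S * compr V T := by
  ext v
  have h := compr_coe hP hT v
  change ContinuousLinearMap.adjoint V.toContinuousLinearMap (S (T (V v))) =
    ContinuousLinearMap.adjoint V.toContinuousLinearMap (S (V (compr V T v)))
  rw [h]

lemma comm_star (hPsa : IsSelfAdjoint P) {T : H →L[ℂ] H} (hT : T * P = P * T) :
    star T * P = P * star T := by
  have h := congrArg star hT
  rw [star_mul, star_mul, hPsa.star_eq] at h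
  exact h.symm

lemma compr_mul' (hP : ProjTo V P) (hPsa : IsSelfAdjoint P) {S : H →L[ℂ] H}
    (hS : S * P = P * S) (T : H →L[ℂ] H) :
    compr V (S * T) = compr V S * compr V T := by
  have h := compr_mul hP (star T) (comm_star hPsa hS)
  rw [← star_mul, compr_star, compr_star, compr_star, ← star_mul] at h
  exact star_injective h

lemma compr_continuous : Continuous (compr V : (H →L[ℂ] H) → (K →L[ℂ] K)) := by
  unfold compr
  fun_prop

lemma comm_closed (P : H →L[ℂ] H) : IsClosed {T : H →L[ℂ] H | T * P = P * T} :=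
  isClosed_eq (by fun_prop) (by fun_prop)

/-- The compression as a homomorphism. -/
def comprHom (hP : ProjTo V P) (O : NonUnitalStarSubalgebra ℂ (H →L[ℂ] H))
    (hO : ∀ a ∈ O, a * P = P * a) : O →⋆ₙₐ[ℂ] (K →L[ℂ] K) where
  toFun a := compr V (a : H →L[ℂ] H)
  map_smul' c a := compr_smul c _
  map_zero' := compr_zero
  map_add' a b := compr_add _ _
  map_mul' a b := compr_mul hP _ (hO b b.2)
  map_star' a := compr_star _

lemma compr_image_closed (hP : ProjTo V P) (O : NonUnitalStarSubalgebra ℂ (H →L[ℂ] H))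
    (hO : ∀ a ∈ O, a * P = P * a) (hOc : IsClosed (O : Set (H →L[ℂ] H))) :
    IsClosed (compr V '' (O : Set (H →L[ℂ] H))) := by
  haveI : IsClosed (O : Set (H →L[ℂ] H)) := hOc
  have hc : Continuous (comprHom hP O hO) := compr_continuous.comp continuous_subtype_val
  have h := aux_closed_range (comprHom hP O hO) hc
  have he : compr V '' (O : Set (H →L[ℂ] H)) = Set.range (comprHom hP O hO) := by
    apply Set.Subset.antisymm
    · rintro _ ⟨a, ha, rfl⟩
      exact ⟨⟨a, ha⟩, rfl⟩
    · rintro _ ⟨a, rfl⟩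
      exact ⟨a, a.2, rfl⟩
  rw [he]
  exact h

end Compr

section Cross

variable {K : Type*} [NormedAddCommGroup K] [InnerProductSpace ℂ K] [CompleteSpace K]
  {V : K →ₗᵢ[ℂ] H} {P : H →L[ℂ] H}

lemma coe_integral_Up {U : ℝ → H →L[ℂ] H} {Up : ℝ → K →L[ℂ] K}
    (hUp : ∀ t (v : K), V (Up t v) = U t (V v)) (hUp1 : IsUnitaryOneParam Up) {f : ℝ → ℂ}
    (hf : Integrable f) (v : K) :
    V (∫ t, f t • Up t v) = ∫ t, f t • U t (V v) := by
  have := V.toContinuousLinearMap.integral_comp_comm (aux_integrable hUp1 hf v)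
  rw [LinearIsometry.coe_toContinuousLinearMap] at this
  rw [← this]
  simp [hUp]

lemma adjoin_down (hP : ProjTo V P) (hPsa : IsSelfAdjoint P)
    {U : ℝ → H →L[ℂ] H} (hU : IsUnitaryOneParam U) {Up : ℝ → K →L[ℂ] K}
    (hUp : ∀ t (v : K), V (Up t v) = U t (V v)) (hUp1 : IsUnitaryOneParam Up)
    (hUP : ∀ t, U t * P = P * U t) (L : H →L[ℂ] H)
    (hL : L ∈ NonUnitalStarAlgebra.adjoin ℂ
      {T : H →L[ℂ] H | ∃ f : ℝ → ℂ, Integrable f ∧ ∀ ψ : H, T ψ = ∫ g, f g • U g ψ}) :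
    L * P = P * L ∧ compr V L ∈ NonUnitalStarAlgebra.adjoin ℂ
      {T : K →L[ℂ] K | ∃ f : ℝ → ℂ, Integrable f ∧ ∀ ψ : K, T ψ = ∫ g, f g • Up g ψ} := by
  induction hL using NonUnitalStarAlgebra.adjoin_induction with
  | mem T hT =>
    obtain ⟨f, hf, hT⟩ := hT
    have hc := aux_commute_op hU hf hT hUP
    refine ⟨hc, NonUnitalStarAlgebra.subset_adjoin ℂ _ ⟨f, hf, fun v => ?_⟩⟩
    apply V.injective
    rw [coe_integral_Up hUp hUp1 hf, compr_coe hP hc, hT]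
  | add x y _ _ hx hy =>
    exact ⟨by rw [add_mul, mul_add, hx.1, hy.1], compr_add (V := V) x y ▸ add_mem hx.2 hy.2⟩
  | zero => exact ⟨by simp, compr_zero (V := V) ▸ zero_mem _⟩
  | mul x y _ _ hx hy =>
    exact ⟨by rw [mul_assoc, hy.1, ← mul_assoc, hx.1, mul_assoc],
      compr_mul hP x hy.1 ▸ mul_mem hx.2 hy.2⟩
  | smul r x _ hx =>
    exact ⟨by rw [smul_mul_assoc, mul_smul_comm, hx.1],
      compr_smul (V := V) r x ▸ SMulMemClass.smul_mem r hx.2⟩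
  | star x _ hx =>
    exact ⟨comm_star hPsa hx.1, compr_star (V := V) x ▸ star_mem hx.2⟩

lemma adjoin_up (hP : ProjTo V P) (hPsa : IsSelfAdjoint P)
    {U : ℝ → H →L[ℂ] H} (hU : IsUnitaryOneParam U) {Up : ℝ → K →L[ℂ] K}
    (hUp : ∀ t (v : K), V (Up t v) = U t (V v)) (hUp1 : IsUnitaryOneParam Up)
    (hUP : ∀ t, U t * P = P * U t) (L : K →L[ℂ] K)
    (hL : L ∈ NonUnitalStarAlgebra.adjoin ℂ
      {T : K →L[ℂ] K | ∃ f : ℝ → ℂ, Integrable f ∧ ∀ ψ : K, T ψ = ∫ g, f g • Up g ψ}) :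
    ∃ L' ∈ NonUnitalStarAlgebra.adjoin ℂ
      {T : H →L[ℂ] H | ∃ f : ℝ → ℂ, Integrable f ∧ ∀ ψ : H, T ψ = ∫ g, f g • U g ψ},
      compr V L' = L := by
  induction hL using NonUnitalStarAlgebra.adjoin_induction with
  | mem T hT =>
    obtain ⟨f, hf, hT⟩ := hT
    obtain ⟨T', hT'⟩ := aux_exists_op hU hf
    have hc := aux_commute_op hU hf hT' hUP
    refine ⟨T', NonUnitalStarAlgebra.subset_adjoin ℂ _ ⟨f, hf, hT'⟩, ?_⟩
    ext v
    apply V.injective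
    rw [hT, coe_integral_Up hUp hUp1 hf, compr_coe hP hc, hT']
  | add x y _ _ hx hy =>
    obtain ⟨x', hx', rfl⟩ := hx
    obtain ⟨y', hy', rfl⟩ := hy
    exact ⟨x' + y', add_mem hx' hy', compr_add _ _⟩
  | zero => exact ⟨0, zero_mem _, compr_zero⟩
  | mul x y _ _ hx hy =>
    obtain ⟨x', hx', rfl⟩ := hx
    obtain ⟨y', hy', rfl⟩ := hy
    exact ⟨x' * y', mul_mem hx' hy',
      compr_mul hP _ (adjoin_down hP hPsa hU hUp hUp1 hUP _ hy').1⟩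
  | smul r x _ hx =>
    obtain ⟨x', hx', rfl⟩ := hx
    exact ⟨r • x', SMulMemClass.smul_mem r hx', compr_smul _ _⟩
  | star x _ hx =>
    obtain ⟨x', hx', rfl⟩ := hx
    exact ⟨star x', star_mem hx', compr_star _⟩

lemma integrated_down (hP : ProjTo V P) (hPsa : IsSelfAdjoint P)
    {U : ℝ → H →L[ℂ] H} (hU : IsUnitaryOneParam U) {Up : ℝ → K →L[ℂ] K}
    (hUp : ∀ t (v : K), V (Up t v) = U t (V v)) (hUp1 : IsUnitaryOneParam Up)
    (hUP : ∀ t, U t * P = P * U t) (L : H →L[ℂ] H)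
    (hL : L ∈ integratedAlgebra (volume : Measure ℝ) U) :
    L * P = P * L ∧ compr V L ∈ integratedAlgebra (volume : Measure ℝ) Up := by
  constructor
  · exact closure_minimal
      (fun T hT => (adjoin_down hP hPsa hU hUp hUp1 hUP T hT).1) (comm_closed P) hL
  · exact map_mem_closure compr_continuous hL
      (fun T hT => (adjoin_down hP hPsa hU hUp hUp1 hUP T hT).2)

/-- The compression as a linear map. -/
def comprLin {K : Type*} [NormedAddCommGroup K] [InnerProductSpace ℂ K]
    [CompleteSpace K] (V : K →ₗᵢ[ℂ] H) : (H →L[ℂ] H) →ₗ[ℂ] (K →L[ℂ] K) where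
  toFun := compr V
  map_add' := compr_add
  map_smul' := compr_smul

lemma cross_down (hP : ProjTo V P) (hPsa : IsSelfAdjoint P)
    {U : ℝ → H →L[ℂ] H} (hU : IsUnitaryOneParam U) {Up : ℝ → K →L[ℂ] K}
    (hUp : ∀ t (v : K), V (Up t v) = U t (V v)) (hUp1 : IsUnitaryOneParam Up)
    (hUP : ∀ t, U t * P = P * U t) (X : H →L[ℂ] H)
    (hX : X ∈ closedRightSpan (integratedAlgebra (volume : Measure ℝ) U)) :
    compr V X ∈ closedRightSpan (integratedAlgebra (volume : Measure ℝ) Up) := by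
  refine map_mem_closure compr_continuous hX ?_
  intro T hT
  have : Submodule.span ℂ {x : H →L[ℂ] H |
      ∃ L ∈ integratedAlgebra (volume : Measure ℝ) U, ∃ B : H →L[ℂ] H, x = L * B} ≤
    (Submodule.span ℂ {x : K →L[ℂ] K |
      ∃ L ∈ integratedAlgebra (volume : Measure ℝ) Up, ∃ B : K →L[ℂ] K, x = L * B}).comap
      (comprLin V) := by
    rw [Submodule.span_le]
    rintro _ ⟨L, hL, B, rfl⟩
    obtain ⟨h1, h2⟩ := integrated_down hP hPsa hU hUp hUp1 hUP L hL
    exact Submodule.subset_span ⟨compr V L, h2, compr V B, compr_mul' hP hPsa h1 B⟩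
  exact this hT

lemma cross_main (hP : ProjTo V P) (hPsa : IsSelfAdjoint P)
    {U : ℝ → H →L[ℂ] H} (hU : IsUnitaryOneParam U) {Up : ℝ → K →L[ℂ] K}
    (hUp : ∀ t (v : K), V (Up t v) = U t (V v)) (hUp1 : IsUnitaryOneParam Up)
    (hUP : ∀ t, U t * P = P * U t) (A O : Set (H →L[ℂ] H)) (hO : O ⊆ A)
    (hOP : ∀ a ∈ O, a * P = P * a)
    (hA : IsCrossRep A (integratedAlgebra (volume : Measure ℝ) U)) :
    IsCrossRep (compr V '' O) (integratedAlgebra (volume : Measure ℝ) Up) := by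
  rintro _ ⟨a, ha, rfl⟩ L hL
  have hcl : IsClosed {L : K →L[ℂ] K | compr V a * L ∈
      closedRightSpan (integratedAlgebra (volume : Measure ℝ) Up)} :=
    isClosed_closure.preimage (continuous_const.mul continuous_id)
  refine closure_minimal ?_ hcl hL
  intro L hL
  obtain ⟨L', hL', rfl⟩ := adjoin_up hP hPsa hU hUp hUp1 hUP L hL
  change compr V a * compr V L' ∈ closedRightSpan (integratedAlgebra (volume : Measure ℝ) Up)
  rw [← compr_mul' hP hPsa (hOP a ha)]
  exact cross_down hP hPsa hU hUp hUp1 hUP _ (hA a (hO ha) L' (subset_closure hL'))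

end Cross

section Invariance

lemma negPart_comm {U : ℝ → H →L[ℂ] H} (hU : IsUnitaryOneParam U) (t : ℝ) (L : H →L[ℂ] H)
    (hL : L ∈ negPartAlgebra U) : L * U t = U t * L := by
  refine closure_minimal ?_ (comm_closed (U t)) hL
  intro T hT
  induction hT using Submodule.span_induction with
  | mem T hT =>
    obtain ⟨f, hf, hT⟩ := hT
    exact aux_commute_op hU hf.1 hT (fun s => by rw [← hU.2.1, ← hU.2.1, add_comm])
  | zero => simp
  | add x y _ _ hx hy =>
    change _ * _ = _ * _ at hx hy
    change _ * _ = _ * _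
    rw [add_mul, mul_add, hx, hy]
  | smul r x _ hx =>
    change _ * _ = _ * _ at hx
    change _ * _ = _ * _
    rw [smul_mul_assoc, mul_smul_comm, hx]

lemma N_inv {U : ℝ → H →L[ℂ] H} (hU : IsUnitaryOneParam U) (N : Submodule ℂ H)
    (hN : (N : Set H) = closure (↑(Submodule.span ℂ
      {v : H | ∃ L ∈ negPartAlgebra U, ∃ ψ : H, v = L ψ}) : Set H)) (t : ℝ) (v : H)
    (hv : v ∈ N) : U t v ∈ N := by
  rw [← SetLike.mem_coe, hN] at hv ⊢
  refine map_mem_closure (U t).continuous hv ?_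
  intro w hw
  have : Submodule.span ℂ {v : H | ∃ L ∈ negPartAlgebra U, ∃ ψ : H, v = L ψ} ≤
    (Submodule.span ℂ {v : H | ∃ L ∈ negPartAlgebra U, ∃ ψ : H, v = L ψ}).comap
      (U t : H →ₗ[ℂ] H) := by
    rw [Submodule.span_le]
    rintro _ ⟨L, hL, ψ, rfl⟩
    refine Submodule.subset_span ⟨L, hL, U t ψ, ?_⟩
    exact (DFunLike.congr_fun (negPart_comm hU t L hL) ψ).symm
  exact this hw

lemma Np_inv {U : ℝ → H →L[ℂ] H} (hU : IsUnitaryOneParam U) (N : Submodule ℂ H)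
    (hN : (N : Set H) = closure (↑(Submodule.span ℂ
      {v : H | ∃ L ∈ negPartAlgebra U, ∃ ψ : H, v = L ψ}) : Set H)) (t : ℝ) (v : H)
    (hv : v ∈ Nᗮ) : U t v ∈ Nᗮ := by
  rw [Submodule.mem_orthogonal] at hv ⊢
  intro u hu
  have h := hv _ (N_inv hU N hN (-t) u hu)
  rw [aux_U_neg hU, ContinuousLinearMap.star_eq_adjoint,
    ContinuousLinearMap.adjoint_inner_left] at h
  exact h

lemma U_inv_apply {U : ℝ → H →L[ℂ] H} (hU : IsUnitaryOneParam U) (t : ℝ) (v : H) :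
    U t (U (-t) v) = v := by
  have h := hU.2.1 t (-t)
  rw [add_neg_cancel, aux_U_zero hU] at h
  exact (DFunLike.congr_fun h v).symm

lemma Up_unitary {U : ℝ → H →L[ℂ] H} (hU : IsUnitaryOneParam U) {K : Type*}
    [NormedAddCommGroup K] [InnerProductSpace ℂ K] [CompleteSpace K] {V : K →ₗᵢ[ℂ] H}
    {Up : ℝ → K →L[ℂ] K} (hUp : ∀ t (v : K), V (Up t v) = U t (V v)) :
    IsUnitaryOneParam Up := by
  have hadd : ∀ s t, Up (s + t) = Up s * Up t := by
    intro s t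
    ext v
    apply V.injective
    rw [hUp, hU.2.1]
    change _ = V (Up s (Up t v))
    rw [hUp, hUp]
    rfl
  have h0 : Up 0 = 1 := by
    ext v
    apply V.injective
    rw [hUp, aux_U_zero hU]
    rfl
  have hstar : ∀ t, star (Up t) = Up (-t) := by
    intro t
    rw [ContinuousLinearMap.star_eq_adjoint]
    symm
    rw [ContinuousLinearMap.eq_adjoint_iff]
    intro x y
    rw [← V.inner_map_map, ← V.inner_map_map (x), hUp, hUp, aux_U_neg hU,
      ContinuousLinearMap.star_eq_adjoint, ContinuousLinearMap.adjoint_inner_left]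
  refine ⟨fun t => ?_, hadd, fun v => ?_⟩
  · rw [Unitary.mem_iff, hstar, ← hadd, ← hadd]
    simp [h0]
  · rw [V.isometry.isEmbedding.continuous_iff]
    have := hU.2.2 (V v)
    convert this using 1
    ext t
    exact hUp t v

end Invariance

/-- Restriction to the non-negative spectral subspace
`𝓗⁺ = (closed span 𝔏₋·𝓗)ᗮ`: it is `U`-invariant, the restricted group `U⁺` has
non-negative spectrum, the commutant-with-`P` part `O` of `A` and its compression `A⁺`
are C*-algebras, and if `(A,U)` is cross then `(A⁺,U⁺)` is a positive cross representation. -/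
theorem restriction_to_nonneg_spectral_subspace
    (U : ℝ → H →L[ℂ] H) (hU : IsUnitaryOneParam U)
    (A : NonUnitalStarSubalgebra ℂ (H →L[ℂ] H))
    (hAclosed : IsClosed (A : Set (H →L[ℂ] H)))
    (hAinv : ∀ t : ℝ, (fun a => U t * a * star (U t)) '' (A : Set (H →L[ℂ] H)) = A)
    (N : Submodule ℂ H)
    (hN : (N : Set H) = closure (↑(Submodule.span ℂ
      {v : H | ∃ L ∈ negPartAlgebra U, ∃ ψ : H, v = L ψ}) : Set H))
    (P : H →L[ℂ] H) (hPidem : IsIdempotentElem P) (hPsa : IsSelfAdjoint P)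
    (hPrange : ∀ ψ : H, P ψ = ψ ↔ ψ ∈ Nᗮ)
    (Up : ℝ → (↥Nᗮ →L[ℂ] ↥Nᗮ)) (hUp : ∀ (t : ℝ) (v : ↥Nᗮ), ((Up t v : H)) = U t (v : H))
    (O : Set (H →L[ℂ] H)) (hO : O = {a : H →L[ℂ] H | a ∈ A ∧ a * P = P * a})
    (Aplus : Set (↥Nᗮ →L[ℂ] ↥Nᗮ))
    (hAplus : Aplus = {S : ↥Nᗮ →L[ℂ] ↥Nᗮ |
      ∃ a ∈ A, a * P = P * a ∧ ∀ v : ↥Nᗮ, ((S v : H)) = a (v : H)}) :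
    -- (a) invariance of 𝓗⁺, U⁺ is a strongly continuous unitary one-parameter group
    -- with non-negative spectrum
    ((∀ t : ℝ, U t '' (Nᗮ : Set H) = (Nᗮ : Set H)) ∧
      IsUnitaryOneParam Up ∧ HasNonnegSpectrum Up) ∧
    -- (b) O is a U-invariant C*-subalgebra of A and A⁺ a U⁺-invariant C*-subalgebra of B(𝓗⁺)
    (((∀ x ∈ O, star x ∈ O) ∧ (∀ x ∈ O, ∀ y ∈ O, x * y ∈ O) ∧
        (∀ x ∈ O, ∀ y ∈ O, x + y ∈ O) ∧ (∀ (c : ℂ), ∀ x ∈ O, c • x ∈ O) ∧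
        IsClosed O ∧ (∀ t : ℝ, (fun a => U t * a * star (U t)) '' O = O)) ∧
      ((∀ x ∈ Aplus, star x ∈ Aplus) ∧ (∀ x ∈ Aplus, ∀ y ∈ Aplus, x * y ∈ Aplus) ∧
        (∀ x ∈ Aplus, ∀ y ∈ Aplus, x + y ∈ Aplus) ∧
        (∀ (c : ℂ), ∀ x ∈ Aplus, c • x ∈ Aplus) ∧ IsClosed Aplus ∧
        (∀ t : ℝ, (fun S => Up t * S * star (Up t)) '' Aplus = Aplus))) ∧
    -- (c) if (A,U) is cross then (A⁺,U⁺) is cross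
    (IsCrossRep (A : Set (H →L[ℂ] H)) (integratedAlgebra (volume : Measure ℝ) U) →
      IsCrossRep Aplus (integratedAlgebra (volume : Measure ℝ) Up)) := by
  let V : ↥Nᗮ →ₗᵢ[ℂ] H := Nᗮ.subtypeₗᵢ
  have hPm : ∀ ψ, P ψ ∈ Nᗮ := by
    refine fun ψ => (hPrange _).1 ?_
    exact DFunLike.congr_fun hPidem ψ
  have hP : ProjTo V P := ⟨fun v => (hPrange v).2 v.2, fun ψ => ⟨⟨P ψ, hPm ψ⟩, rfl⟩⟩
  have hUp1 : IsUnitaryOneParam Up := Up_unitary (V := V) hU hUp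
  have hUP : ∀ t, U t * P = P * U t := by
    have h1 : ∀ t, P * (U t * P) = U t * P := by
      intro t
      ext ψ
      exact (hPrange _).2 (Np_inv hU N hN t _ (hPm ψ))
    intro t
    have h2 := congrArg star (h1 (-t))
    rw [star_mul, star_mul, hPsa.star_eq, aux_U_neg hU, star_star, mul_assoc, h1] at h2
    exact h2
  have hUpc : ∀ t, compr V (U t) = Up t := fun t =>
    ((compr_eq_iff hP (hUP t) (Up t)).2 (hUp t)).symm
  let OA : NonUnitalStarSubalgebra ℂ (H →L[ℂ] H) :=
    { carrier := {a | a ∈ A ∧ a * P = P * a}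
      add_mem' := fun {x y} hx hy =>
        ⟨add_mem hx.1 hy.1, by rw [add_mul, mul_add, hx.2, hy.2]⟩
      zero_mem' := ⟨zero_mem _, by simp⟩
      mul_mem' := fun {x y} hx hy =>
        ⟨mul_mem hx.1 hy.1, by rw [mul_assoc, hy.2, ← mul_assoc, hx.2, mul_assoc]⟩
      smul_mem' := fun c x hx =>
        ⟨SMulMemClass.smul_mem c hx.1, by rw [smul_mul_assoc, mul_smul_comm, hx.2]⟩
      star_mem' := fun {x} hx => ⟨star_mem hx.1, comm_star hPsa hx.2⟩ }
  have hOA : O = (OA : Set (H →L[ℂ] H)) := hO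
  have hOP : ∀ a ∈ OA, a * P = P * a := fun a ha => ha.2
  have hOc : IsClosed (OA : Set (H →L[ℂ] H)) := hAclosed.inter (comm_closed P)
  have hAp : Aplus = compr V '' (OA : Set (H →L[ℂ] H)) := by
    rw [hAplus]
    ext S
    constructor
    · rintro ⟨a, ha, hc, h⟩
      exact ⟨a, ⟨ha, hc⟩, ((compr_eq_iff hP hc S).2 h).symm⟩
    · rintro ⟨a, ⟨ha, hc⟩, rfl⟩
      exact ⟨a, ha, hc, compr_coe hP hc⟩
  have hOconj : ∀ t, (fun a => U t * a * star (U t)) '' (OA : Set (H →L[ℂ] H)) = OA := by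
    have h1 : ∀ t, ∀ a ∈ OA, U t * a * star (U t) ∈ OA := by
      intro t a ha
      refine ⟨?_, ?_⟩
      · have : U t * a * star (U t) ∈ (A : Set (H →L[ℂ] H)) := by
          rw [← hAinv t]
          exact ⟨a, ha.1, rfl⟩
        exact this
      · rw [mul_assoc, comm_star hPsa (hUP t), ← mul_assoc, mul_assoc (U t), ha.2, ← mul_assoc,
          hUP t]
        simp only [mul_assoc]
    intro t
    apply Set.Subset.antisymm
    · rintro _ ⟨a, ha, rfl⟩
      exact h1 t a ha
    · intro a ha
      refine ⟨_, h1 (-t) a ha, ?_⟩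
      have e := (Unitary.mem_iff.1 (hU.1 t)).2
      simp only [aux_U_neg hU, star_star]
      calc U t * (star (U t) * a * U t) * star (U t)
          = (U t * star (U t)) * a * (U t * star (U t)) := by simp only [mul_assoc]
        _ = a := by rw [e, one_mul, mul_one]
  refine ⟨⟨?_, hUp1, ?_⟩, ⟨?_, ?_⟩, ?_⟩
  · intro t
    apply Set.Subset.antisymm
    · rintro _ ⟨v, hv, rfl⟩
      exact Np_inv hU N hN t v hv
    · intro v hv
      exact ⟨U (-t) v, Np_inv hU N hN (-t) v hv, U_inv_apply hU t v⟩
  · intro f hf v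
    obtain ⟨T, hT⟩ := aux_exists_op hU hf.1
    have hTn : T ∈ negPartAlgebra U := subset_closure (Submodule.subset_span ⟨f, hf, hT⟩)
    have h1 : T (v : H) ∈ N := by
      rw [← SetLike.mem_coe, hN]
      exact subset_closure (Submodule.subset_span ⟨T, hTn, v, rfl⟩)
    have h2 : T (v : H) ∈ Nᗮ := by
      obtain ⟨w, hw⟩ := mem_of_comm hP (aux_commute_op hU hf.1 hT hUP) v
      exact hw ▸ w.2
    apply V.injective
    rw [coe_integral_Up (V := V) hUp hUp1 hf.1, ← hT, map_zero]
    have h3 := (Submodule.mem_orthogonal _ _).1 h2 _ h1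
    exact inner_self_eq_zero.1 h3
  · rw [hOA]
    exact ⟨fun x hx => star_mem hx, fun x hx y hy => mul_mem hx hy,
      fun x hx y hy => add_mem hx hy, fun c x hx => OA.smul_mem' c hx, hOc, hOconj⟩
  · rw [hAp]
    refine ⟨?_, ?_, ?_, ?_, compr_image_closed hP OA hOP hOc, ?_⟩
    · rintro _ ⟨a, ha, rfl⟩
      exact ⟨star a, star_mem ha, compr_star a⟩
    · rintro _ ⟨a, ha, rfl⟩ _ ⟨b, hb, rfl⟩
      exact ⟨a * b, OA.mul_mem' ha hb, compr_mul hP a (hOP b hb)⟩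
    · rintro _ ⟨a, ha, rfl⟩ _ ⟨b, hb, rfl⟩
      exact ⟨a + b, OA.add_mem' ha hb, compr_add a b⟩
    · rintro c _ ⟨a, ha, rfl⟩
      exact ⟨c • a, OA.smul_mem' c ha, compr_smul c a⟩
    · intro t
      conv_rhs => rw [← hOconj t]
      rw [Set.image_image, Set.image_image]
      apply Set.image_congr
      intro a ha
      rw [compr_mul hP _ (comm_star hPsa (hUP t)), compr_mul hP _ (hOP a ha), compr_star, hUpc]
  · intro hA
    rw [hAp]
    exact cross_main hP hPsa hU hUp hUp1 hUP A OA (fun a ha => ha.1) hOP hA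
end
end

section
/- Let M be a von Neumann algebra on a nonzero complex Hilbert space 𝓗 and let V : ℝ → U(𝓗) be a strongly continuous one-parameter unitary group with V_t ∈ M for all t. Then 𝔙 := 𝔏_V ⊆ M, and the C*-subalgebra C_V of B(𝓗) generated by the products 𝔙·M satisfies C_V ⊆ M. Moreover, the following are equivalent: (i) for every m ∈ M, m·𝔙 ⊆ closed linear span of 𝔙·B(𝓗) (i.e. (M,V) is a cross representation); (ii) C_V is a nonzero closed two-sided ideal of M contained in M_c := {m ∈ M : t ↦ V_t m V_t⁻¹ is norm-continuous}. -/
open MeasureTheory Filter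

noncomputable section

variable {H : Type*} [NormedAddCommGroup H] [InnerProductSpace ℂ H] [CompleteSpace H]

open Topology

/-- Operators `x` with `V_t x → x` in norm as `t → 0`. -/
def KS (V : ℝ → H →L[ℂ] H) : Set (H →L[ℂ] H) :=
  {x | Tendsto (fun t => V t * x) (𝓝 0) (𝓝 x)}

lemma V_norm_le {V : ℝ → H →L[ℂ] H} (hV : IsUnitaryOneParam V) (t : ℝ) : ‖V t‖ ≤ 1 := by
  exact ContinuousLinearMap.opNorm_le_bound _ zero_le_one fun x => by
    rw [one_mul, ContinuousLinearMap.norm_map_of_mem_unitary (hV.1 t)]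

lemma V_apply_le {V : ℝ → H →L[ℂ] H} (hV : IsUnitaryOneParam V) (t : ℝ) (x : H) :
    ‖V t x‖ ≤ ‖x‖ := by
  refine ((V t).le_opNorm x).trans ?_
  have := V_norm_le hV t
  nlinarith [norm_nonneg x]

lemma V_zero {V : ℝ → H →L[ℂ] H} (hV : IsUnitaryOneParam V) : V 0 = 1 := by
  have h := hV.2.1 0 0
  rw [add_zero] at h
  have h1 := (Unitary.mem_iff.1 (hV.1 0)).1
  calc V 0 = star (V 0) * V 0 * V 0 := by rw [h1, one_mul]
    _ = star (V 0) * V 0 := by rw [mul_assoc, ← h]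
    _ = 1 := h1

lemma V_star {V : ℝ → H →L[ℂ] H} (hV : IsUnitaryOneParam V) (t : ℝ) : star (V t) = V (-t) := by
  have h := hV.2.1 t (-t)
  rw [add_neg_cancel, V_zero hV] at h
  have h1 := (Unitary.mem_iff.1 (hV.1 t)).1
  calc star (V t) = star (V t) * (V t * V (-t)) := by rw [← h, mul_one]
    _ = V (-t) := by rw [← mul_assoc, h1, one_mul]

lemma KS_iff {V : ℝ → H →L[ℂ] H} {x : H →L[ℂ] H} :
    x ∈ KS V ↔ Tendsto (fun t => ‖V t * x - x‖) (𝓝 0) (𝓝 0) :=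
  tendsto_iff_norm_sub_tendsto_zero

lemma KS_closed {V : ℝ → H →L[ℂ] H} (hV : IsUnitaryOneParam V) : IsClosed (KS V) := by
  rw [← closure_subset_iff_isClosed]
  intro y hy
  rw [Metric.mem_closure_iff] at hy
  show Tendsto _ _ _
  rw [Metric.tendsto_nhds]
  intro ε hε
  obtain ⟨x, hx, hxy⟩ := hy (ε / 3) (by positivity)
  have hx' : Tendsto _ _ _ := hx
  rw [Metric.tendsto_nhds] at hx'
  filter_upwards [hx' (ε / 3) (by positivity)] with t ht
  rw [dist_eq_norm] at *
  have e : V t * y - y = V t * (y - x) + (V t * x - x) - (y - x) := by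
    rw [mul_sub]; abel
  have h1 : ‖V t * (y - x)‖ ≤ ‖y - x‖ := by
    refine (norm_mul_le _ _).trans ?_
    have := V_norm_le hV t
    nlinarith [norm_nonneg (y - x)]
  rw [e]
  calc _ ≤ ‖V t * (y - x)‖ + ‖V t * x - x‖ + ‖y - x‖ :=
        (norm_sub_le _ _).trans (by gcongr; exact norm_add_le _ _)
    _ < ε := by linarith

lemma KS_add {V : ℝ → H →L[ℂ] H} {x y : H →L[ℂ] H} (hx : x ∈ KS V) (hy : y ∈ KS V) :
    x + y ∈ KS V := by
  have := Tendsto.add (show Tendsto _ _ _ from hx) (show Tendsto _ _ _ from hy)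
  simpa [KS, mul_add] using this

lemma KS_zero {V : ℝ → H →L[ℂ] H} : (0 : H →L[ℂ] H) ∈ KS V := by
  simp [KS]

lemma KS_smul {V : ℝ → H →L[ℂ] H} {x : H →L[ℂ] H} (c : ℂ) (hx : x ∈ KS V) :
    c • x ∈ KS V := by
  have := Tendsto.const_smul (show Tendsto _ _ _ from hx) c
  simpa [KS, mul_smul_comm] using this

lemma KS_mul {V : ℝ → H →L[ℂ] H} {x : H →L[ℂ] H} (hx : x ∈ KS V) (y : H →L[ℂ] H) :
    x * y ∈ KS V := by
  have := Tendsto.mul_const y (show Tendsto _ _ _ from hx)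
  simpa [KS, mul_assoc] using this

/-- The two-sided version of `KS`. -/
def KK (V : ℝ → H →L[ℂ] H) : NonUnitalStarSubalgebra ℂ (H →L[ℂ] H) where
  carrier := {x | x ∈ KS V ∧ star x ∈ KS V}
  add_mem' := fun hx hy => ⟨KS_add hx.1 hy.1, by rw [star_add]; exact KS_add hx.2 hy.2⟩
  zero_mem' := ⟨KS_zero, by rw [star_zero]; exact KS_zero⟩
  mul_mem' := fun hx hy => ⟨KS_mul hx.1 _, by rw [star_mul]; exact KS_mul hy.2 _⟩
  smul_mem' := fun c x hx => ⟨KS_smul c hx.1, by rw [star_smul]; exact KS_smul _ hx.2⟩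
  star_mem' := fun hx => ⟨hx.2, by rw [star_star]; exact hx.1⟩

lemma mem_KK {V : ℝ → H →L[ℂ] H} {x : H →L[ℂ] H} : x ∈ KK V ↔ x ∈ KS V ∧ star x ∈ KS V := Iff.rfl

lemma KK_closed {V : ℝ → H →L[ℂ] H} (hV : IsUnitaryOneParam V) :
    IsClosed (KK V : Set (H →L[ℂ] H)) :=
  (KS_closed hV).inter ((KS_closed hV).preimage continuous_star)

lemma smul_integrable {V : ℝ → H →L[ℂ] H} (hV : IsUnitaryOneParam V) {f : ℝ → ℂ}
    (hf : Integrable f) (ψ : H) : Integrable (fun t => f t • V t ψ) := by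
  refine Integrable.mono' (hf.norm.mul_const ‖ψ‖)
    (hf.aestronglyMeasurable.smul (hV.2.2 ψ).aestronglyMeasurable) (ae_of_all _ fun t => ?_)
  rw [norm_smul]
  gcongr
  exact V_apply_le hV t ψ

lemma transl_tendsto {f : ℝ → ℂ} (hf : Integrable f) :
    Tendsto (fun t : ℝ => ∫ s, ‖f (t + s) - f s‖) (𝓝 0) (𝓝 0) := by
  have hm : MemLp f 1 (volume : Measure ℝ) := memLp_one_iff_integrable.2 hf
  haveI : Fact ((1 : ENNReal) ≠ ⊤) := ⟨by simp⟩
  have hc : Continuous (fun t : ℝ => (DomAddAct.mk t) +ᵥ (hm.toLp f)) := by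
    have h0 : Continuous (fun t : ℝ => DomAddAct.mk t) := DomAddAct.continuous_mk
    exact h0.vadd continuous_const
  have h1 : Tendsto (fun t : ℝ => ‖(DomAddAct.mk t +ᵥ hm.toLp f) - hm.toLp f‖) (𝓝 0)
      (𝓝 ‖(DomAddAct.mk (0 : ℝ) +ᵥ hm.toLp f) - hm.toLp f‖) :=
    (hc.sub (continuous_const (y := hm.toLp f))).norm.tendsto 0
  have key : ∀ t : ℝ, ‖(DomAddAct.mk t +ᵥ hm.toLp f) - hm.toLp f‖ = ∫ s, ‖f (t + s) - f s‖ := by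
    intro t
    rw [DomAddAct.mk_vadd_toLp, ← MemLp.toLp_sub, L1.norm_eq_integral_norm]
    refine integral_congr_ae ?_
    filter_upwards [MemLp.coeFn_toLp ((hm.comp_measurePreserving
      (measurePreserving_vadd t volume)).sub hm)] with s hs
    exact congrArg norm hs
  simp only [key] at h1
  simpa using h1

lemma gen_mem_KS {V : ℝ → H →L[ℂ] H} (hV : IsUnitaryOneParam V) {f : ℝ → ℂ} (hf : Integrable f)
    {T : H →L[ℂ] H} (hT : ∀ ψ, T ψ = ∫ t, f t • V t ψ) : T ∈ KS V := by
  rw [KS_iff]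
  have h0 : Tendsto (fun t : ℝ => ∫ s, ‖f (-t + s) - f s‖) (𝓝 0) (𝓝 0) := by
    have := (transl_tendsto hf).comp (show Tendsto (fun t : ℝ => -t) (𝓝 0) (𝓝 0) by
      simpa using (continuous_neg (G := ℝ)).tendsto 0)
    exact this
  refine squeeze_zero (fun _ => norm_nonneg _) (fun t => ?_) h0
  refine ContinuousLinearMap.opNorm_le_bound _ (integral_nonneg fun _ => norm_nonneg _) fun ψ => ?_
  have hft : Integrable (fun s => f (-t + s)) := hf.comp_add_left (-t)
  have e : (V t * T - T) ψ = ∫ s, (f (-t + s) - f s) • V s ψ := by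
    have e1 : V t (T ψ) = ∫ s, f (-t + s) • V s ψ := by
      rw [hT, ← ContinuousLinearMap.integral_comp_comm _ (smul_integrable hV hf ψ),
        ← integral_add_left_eq_self (fun s => f (-t + s) • V s ψ) t]
      congr 1; ext s
      rw [map_smul, hV.2.1]
      simp
    show V t (T ψ) - T ψ = _
    rw [e1, hT,
      ← integral_sub (smul_integrable hV hft ψ) (smul_integrable hV hf ψ)]
    simp only [sub_smul]
  rw [e, ← integral_mul_const]
  refine norm_integral_le_of_norm_le ((hft.sub hf).norm.mul_const _) (ae_of_all _ fun s => ?_)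
  rw [norm_smul]
  gcongr
  exact V_apply_le hV s ψ

lemma gen_comm {V : ℝ → H →L[ℂ] H} (hV : IsUnitaryOneParam V) {f : ℝ → ℂ} (hf : Integrable f)
    {T : H →L[ℂ] H} (hT : ∀ ψ, T ψ = ∫ t, f t • V t ψ) (y : H →L[ℂ] H)
    (hy : ∀ t, y * V t = V t * y) : y * T = T * y := by
  ext ψ
  show y (T ψ) = T (y ψ)
  rw [hT, hT, ← ContinuousLinearMap.integral_comp_comm _ (smul_integrable hV hf ψ)]
  congr 1; ext s
  rw [map_smul]
  congr 1
  exact congrArg (fun A : H →L[ℂ] H => A ψ) (hy s)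

lemma gen_mem_KK {V : ℝ → H →L[ℂ] H} (hV : IsUnitaryOneParam V) {f : ℝ → ℂ} (hf : Integrable f)
    {T : H →L[ℂ] H} (hT : ∀ ψ, T ψ = ∫ t, f t • V t ψ) : T ∈ KK V := by
  have h := gen_mem_KS hV hf hT
  refine ⟨h, ?_⟩
  have h1 : Tendsto (fun t => star (V (-t) * T)) (𝓝 0) (𝓝 (star T)) :=
    (continuous_star.tendsto T).comp ((show Tendsto _ _ _ from h).comp
      (show Tendsto (fun t : ℝ => -t) (𝓝 0) (𝓝 0) by
        simpa using (continuous_neg (G := ℝ)).tendsto 0))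
  refine h1.congr fun t => ?_
  rw [gen_comm hV hf hT (V (-t)) (fun s => by rw [← hV.2.1, ← hV.2.1, add_comm]),
    star_mul, V_star hV, neg_neg]

lemma integrated_sub_KK {V : ℝ → H →L[ℂ] H} (hV : IsUnitaryOneParam V) :
    integratedAlgebra (volume : Measure ℝ) V ⊆ KK V := by
  refine closure_minimal ?_ (KK_closed hV)
  refine NonUnitalStarAlgebra.adjoin_le ?_
  rintro T ⟨f, hf, hT⟩
  exact gen_mem_KK hV hf hT

lemma vN_closed (M : VonNeumannAlgebra H) : IsClosed (M : Set (H →L[ℂ] H)) := by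
  rw [← M.centralizer_centralizer]
  exact Set.isClosed_centralizer _

lemma integrated_sub_M {V : ℝ → H →L[ℂ] H} (hV : IsUnitaryOneParam V) (M : VonNeumannAlgebra H)
    (hVM : ∀ t : ℝ, V t ∈ M) :
    integratedAlgebra (volume : Measure ℝ) V ⊆ (M : Set (H →L[ℂ] H)) := by
  refine closure_minimal ?_ (vN_closed M)
  refine NonUnitalStarAlgebra.adjoin_le
    (S := M.toStarSubalgebra.toNonUnitalStarSubalgebra) ?_
  rintro T ⟨f, hf, hT⟩
  show T ∈ (M : Set (H →L[ℂ] H))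
  rw [← M.centralizer_centralizer]
  intro y hy
  exact gen_comm hV hf hT y fun t => (hy (V t) (hVM t)).symm

lemma exists_avg {V : ℝ → H →L[ℂ] H} (hV : IsUnitaryOneParam V) {δ : ℝ} (hδ : 0 < δ) :
    ∃ e ∈ integratedAlgebra (volume : Measure ℝ) V, ∀ (φ : H) (c : ℝ),
      (∀ t ∈ Set.Ioc 0 δ, ‖V t φ - φ‖ ≤ c) → ‖e φ - φ‖ ≤ c := by
  set f : ℝ → ℂ := (Set.Ioc 0 δ).indicator (fun _ => ((δ⁻¹ : ℝ) : ℂ)) with hfdef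
  have hfi : ∀ {E : Type _} [NormedAddCommGroup E] (a : E),
      Integrable ((Set.Ioc 0 δ).indicator (fun _ : ℝ => a)) := fun a =>
    (integrable_indicator_iff measurableSet_Ioc).2 (integrableOn_const (by simp))
  have hf : Integrable f := hfi _
  let T : H →L[ℂ] H := LinearMap.mkContinuous
    { toFun := fun ψ => ∫ t, f t • V t ψ
      map_add' := fun a b => by
        rw [← integral_add (smul_integrable hV hf a) (smul_integrable hV hf b)]
        simp only [map_add, smul_add]
      map_smul' := fun c a => by
        rw [RingHom.id_apply, ← integral_smul]
        congr 1; ext t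
        rw [map_smul, smul_comm] } (∫ t, ‖f t‖) (fun ψ => by
      show ‖∫ t, f t • V t ψ‖ ≤ _
      rw [← integral_mul_const]
      refine norm_integral_le_of_norm_le (hf.norm.mul_const _) (ae_of_all _ fun s => ?_)
      rw [norm_smul]
      gcongr
      exact V_apply_le hV s ψ)
  have hT : ∀ ψ, T ψ = ∫ t, f t • V t ψ := fun ψ => rfl
  refine ⟨T, subset_closure (NonUnitalStarAlgebra.subset_adjoin ℂ _ ⟨f, hf, hT⟩), ?_⟩
  intro φ c hc
  have hone : ∫ t, f t = 1 := by
    rw [hfdef, integral_indicator measurableSet_Ioc, setIntegral_const]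
    simp [hδ.le, hδ.ne']
  have e : T φ - φ = ∫ t, f t • (V t φ - φ) := by
    simp only [smul_sub]
    rw [integral_sub (smul_integrable hV hf φ) (hf.smul_const φ), integral_smul_const, hone,
      one_smul, hT]
  have hg : ∫ t, (Set.Ioc 0 δ).indicator (fun _ : ℝ => δ⁻¹ * c) t = c := by
    rw [integral_indicator measurableSet_Ioc, setIntegral_const]
    simp [hδ.le, hδ.ne']
  rw [e, ← hg]
  refine norm_integral_le_of_norm_le (hfi _) (ae_of_all _ fun t => ?_)
  by_cases ht : t ∈ Set.Ioc 0 δ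
  · simp only [hfdef, Set.indicator_of_mem ht, norm_smul]
    rw [Complex.norm_real, Real.norm_of_nonneg (by positivity)]
    gcongr
    exact hc t ht
  · simp [hfdef, Set.indicator_of_notMem ht]

lemma exists_approx {V : ℝ → H →L[ℂ] H} (hV : IsUnitaryOneParam V) {x : H →L[ℂ] H}
    (hx : x ∈ KS V) {ε : ℝ} (hε : 0 < ε) :
    ∃ e ∈ integratedAlgebra (volume : Measure ℝ) V, ‖e * x - x‖ ≤ ε := by
  rw [KS_iff, Metric.tendsto_nhds_nhds] at hx
  obtain ⟨δ, hδ, h⟩ := hx ε hε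
  obtain ⟨e, he, h2⟩ := exists_avg hV (half_pos hδ)
  refine ⟨e, he, ContinuousLinearMap.opNorm_le_bound _ hε.le fun ψ => ?_⟩
  refine h2 (x ψ) _ fun t ht => ?_
  have h3 : ‖V t * x - x‖ ≤ ε := by
    have := h (x := t) (by
      rw [Real.dist_eq, sub_zero, abs_of_pos ht.1]; linarith [ht.2])
    rw [Real.dist_eq, sub_zero, abs_of_nonneg (norm_nonneg _)] at this
    exact this.le
  exact ((V t * x - x).le_opNorm ψ).trans (by gcongr)

lemma mem_closure_of_KS {V : ℝ → H →L[ℂ] H} (hV : IsUnitaryOneParam V) {x : H →L[ℂ] H}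
    (hx : x ∈ KS V) {S : Set (H →L[ℂ] H)}
    (hS : ∀ e ∈ integratedAlgebra (volume : Measure ℝ) V, e * x ∈ S) : x ∈ closure S := by
  rw [Metric.mem_closure_iff]
  intro ε hε
  obtain ⟨e, he, h⟩ := exists_approx hV hx (half_pos hε)
  refine ⟨e * x, hS e he, ?_⟩
  rw [dist_comm, dist_eq_norm]
  linarith

lemma closedRightSpan_sub_KS {V : ℝ → H →L[ℂ] H} (hV : IsUnitaryOneParam V) :
    closedRightSpan (integratedAlgebra (volume : Measure ℝ) V) ⊆ KS V := by
  refine closure_minimal ?_ (KS_closed hV)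
  intro x hx
  refine Submodule.span_induction (p := fun x _ => x ∈ KS V) ?_ KS_zero
    (fun _ _ _ _ h1 h2 => KS_add h1 h2) (fun c _ _ h => KS_smul c h) hx
  rintro x ⟨L, hL, B, rfl⟩
  exact KS_mul (integrated_sub_KK hV hL).1 B

lemma KK_continuous {V : ℝ → H →L[ℂ] H} (hV : IsUnitaryOneParam V) {x : H →L[ℂ] H}
    (hx : x ∈ KK V) : Continuous fun t : ℝ => V t * x * star (V t) := by
  rw [continuous_iff_continuousAt]
  intro s
  show Tendsto _ _ _
  rw [tendsto_iff_norm_sub_tendsto_zero]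
  have hs : Tendsto (fun t : ℝ => t - s) (𝓝 s) (𝓝 0) := by
    simpa using (continuous_sub_right s).tendsto s
  have h1 := (KS_iff.1 hx.1).comp hs
  have h2 := (KS_iff.1 hx.2).comp hs
  have h3 := h1.add h2
  rw [add_zero] at h3
  refine squeeze_zero (fun _ => norm_nonneg _) (fun t => ?_) h3
  have n1 : ∀ t, ‖V t‖ ≤ 1 := V_norm_le hV
  have n2 : ∀ t, ‖star (V t)‖ ≤ 1 := fun t => by rw [norm_star]; exact n1 t
  have n3 : ∀ a b c : H →L[ℂ] H, ‖a‖ ≤ 1 → ‖c‖ ≤ 1 → ‖a * b * c‖ ≤ ‖b‖ := by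
    intro a b c ha hc
    calc ‖a * b * c‖ ≤ ‖a * b‖ * ‖c‖ := norm_mul_le _ _
      _ ≤ (‖a‖ * ‖b‖) * ‖c‖ := by gcongr; exact norm_mul_le _ _
      _ ≤ (1 * ‖b‖) * 1 := by gcongr
      _ = ‖b‖ := by ring
  have ht : V t = V s * V (t - s) := by rw [← hV.2.1]; congr 1; ring
  have e : V t * x * star (V t) - V s * x * star (V s)
      = V s * (V (t - s) * x - x) * star (V t)
        + V s * star (V (t - s) * star x - star x) * star (V s) := by
    rw [star_sub, star_mul, star_star, ht, star_mul]
    noncomm_ring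
  rw [e]
  refine (norm_add_le _ _).trans (add_le_add (n3 _ _ _ (n1 _) (n2 _)) ?_)
  refine (n3 _ _ _ (n1 _) (n2 _)).trans ?_
  rw [norm_star]
  rfl

lemma KS_of_continuous {V : ℝ → H →L[ℂ] H} (hV : IsUnitaryOneParam V) {x : H →L[ℂ] H}
    (hx : Continuous fun t : ℝ => V t * x * star (V t)) (hs : star x ∈ KS V) : x ∈ KS V := by
  have h1 := hx.tendsto 0
  rw [V_zero hV, one_mul, star_one, mul_one, tendsto_iff_norm_sub_tendsto_zero] at h1
  have hneg : Tendsto (fun t : ℝ => -t) (𝓝 0) (𝓝 0) := by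
    simpa using (continuous_neg (G := ℝ)).tendsto 0
  have h2 := (KS_iff.1 hs).comp hneg
  have h3 := h1.add h2
  rw [add_zero] at h3
  rw [KS_iff]
  refine squeeze_zero (fun _ => norm_nonneg _) (fun t => ?_) h3
  have hu : star (V t) * V t = 1 := (Unitary.mem_iff.1 (hV.1 t)).1
  have e : V t * x - x = (V t * x * star (V t) - x) * V t
      + star (V (-t) * star x - star x) := by
    rw [star_sub, star_mul, star_star, V_star hV, V_star hV, neg_neg, sub_mul]
    rw [V_star hV] at hu
    rw [mul_assoc (V t * x), hu, mul_one]
    abel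
  rw [e]
  refine (norm_add_le _ _).trans (add_le_add ?_ (by rw [norm_star]; rfl))
  refine (norm_mul_le _ _).trans (mul_le_of_le_one_right (norm_nonneg _) (V_norm_le hV t))

/-- For an inner one-parameter group `V` of a von Neumann algebra `M` on a
nonzero Hilbert space, `𝔏_V ⊆ M`, the C*-algebra `C_V` generated by `𝔏_V·M` lies in `M`, and
`(M,V)` is a cross representation iff `C_V` is a nonzero closed two-sided ideal of `M`
contained in the continuity subalgebra `M_c`. -/
theorem inner_cross_iff_continuity_ideal [Nontrivial H]
    (M : VonNeumannAlgebra H)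
    (V : ℝ → H →L[ℂ] H) (hV : IsUnitaryOneParam V) (hVM : ∀ t : ℝ, V t ∈ M)
    (CV : Set (H →L[ℂ] H))
    (hCV : CV = closure (↑(NonUnitalStarAlgebra.adjoin ℂ
      {x : H →L[ℂ] H | ∃ L ∈ integratedAlgebra (volume : Measure ℝ) V, ∃ m ∈ M, x = L * m}) :
        Set (H →L[ℂ] H))) :
    integratedAlgebra (volume : Measure ℝ) V ⊆ (M : Set (H →L[ℂ] H)) ∧
    CV ⊆ (M : Set (H →L[ℂ] H)) ∧
    (IsCrossRep (M : Set (H →L[ℂ] H)) (integratedAlgebra (volume : Measure ℝ) V) ↔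
      ((∃ x ∈ CV, x ≠ 0) ∧ IsClosed CV ∧
        (∀ m ∈ M, ∀ x ∈ CV, m * x ∈ CV ∧ x * m ∈ CV) ∧
        (∀ x ∈ CV, Continuous fun t : ℝ => V t * x * star (V t)))) := by
  set A := integratedAlgebra (volume : Measure ℝ) V with hA
  set S : Set (H →L[ℂ] H) := {x | ∃ L ∈ A, ∃ m ∈ M, x = L * m} with hS
  have hAM : A ⊆ (M : Set (H →L[ℂ] H)) := integrated_sub_M hV M hVM
  have hAK : A ⊆ KK V := integrated_sub_KK hV
  have hCM : CV ⊆ (M : Set (H →L[ℂ] H)) := by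
    rw [hCV]
    refine closure_minimal ?_ (vN_closed M)
    refine NonUnitalStarAlgebra.adjoin_le
      (S := M.toStarSubalgebra.toNonUnitalStarSubalgebra) ?_
    rintro x ⟨L, hL, m, hm, rfl⟩
    exact mul_mem (S := VonNeumannAlgebra H) (hAM hL) hm
  have hSC : ∀ L ∈ A, ∀ m ∈ M, L * m ∈ CV := by
    intro L hL m hm
    rw [hCV]
    exact subset_closure (NonUnitalStarAlgebra.subset_adjoin ℂ _ ⟨L, hL, m, hm, rfl⟩)
  have hAC : ∀ L ∈ A, L ∈ CV := fun L hL => by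
    simpa using hSC L hL 1 (one_mem M)
  have hcl : IsClosed CV := by rw [hCV]; exact isClosed_closure
  refine ⟨hAM, hCM, ?_, ?_⟩
  · intro hcross
    have hMA : ∀ m ∈ M, ∀ L ∈ A, m * L ∈ KS V := fun m hm L hL =>
      closedRightSpan_sub_KS hV (hcross m hm L hL)
    have hstarA : ∀ L ∈ A, star L ∈ A := by
      intro L hL
      have := map_mem_closure (continuous_star (R := H →L[ℂ] H)) hL
        (t := (NonUnitalStarAlgebra.adjoin ℂ {T : H →L[ℂ] H | ∃ f : ℝ → ℂ,
          Integrable f volume ∧ ∀ ψ : H, T ψ = ∫ g, f g • V g ψ ∂volume} : Set (H →L[ℂ] H)))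
        (fun x hx => star_mem hx)
      exact this
    have hCK : CV ⊆ KK V := by
      rw [hCV]
      refine closure_minimal ?_ (KK_closed hV)
      refine NonUnitalStarAlgebra.adjoin_le ?_
      rintro x ⟨L, hL, m, hm, rfl⟩
      refine ⟨KS_mul (hAK hL).1 m, ?_⟩
      rw [star_mul]
      exact hMA _ (star_mem hm) _ (hstarA L hL)
    have hKC : ∀ x ∈ M, x ∈ KS V → x ∈ CV := by
      intro x hx hk
      rw [← hcl.closure_eq]
      exact mem_closure_of_KS hV hk fun e he => hSC e he x hx
    have hleft : ∀ m ∈ M, ∀ x ∈ CV, m * x ∈ CV := by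
      intro m hm x hx
      refine hKC _ (mul_mem hm (hCM hx)) ?_
      have : x ∈ closure ((fun y => m * y) ⁻¹' KS V) := by
        refine mem_closure_of_KS hV (hCK hx).1 fun e he => ?_
        show m * (e * x) ∈ KS V
        rw [← mul_assoc]
        exact KS_mul (hMA m hm e he) x
      rwa [((KS_closed hV).preimage (continuous_const_mul m)).closure_eq] at this
    refine ⟨?_, hcl, fun m hm x hx => ⟨hleft m hm x hx, ?_⟩, fun x hx => KK_continuous hV (hCK hx)⟩
    · obtain ⟨ψ, hψ⟩ := exists_ne (0 : H)
      have hc := (hV.2.2 ψ).tendsto 0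
      rw [Metric.tendsto_nhds_nhds] at hc
      have hψ' : 0 < ‖ψ‖ := norm_pos_iff.2 hψ
      obtain ⟨δ, hδ, h⟩ := hc (‖ψ‖ / 2) (by positivity)
      obtain ⟨e, he, h2⟩ := exists_avg hV (half_pos hδ)
      refine ⟨e, hAC e he, ?_⟩
      rintro rfl
      have h3 := h2 ψ (‖ψ‖ / 2) fun t ht => by
        have := h (x := t) (by
          rw [Real.dist_eq, sub_zero, abs_of_pos ht.1]; linarith [ht.2])
        rw [V_zero hV, dist_eq_norm] at this
        exact this.le
      simp at h3
      linarith
    · exact hKC _ (mul_mem (hCM hx) hm) (KS_mul (hCK hx).1 m)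
  · rintro ⟨-, -, hid, hcont⟩ m hm L hL
    have h1 := (hid m hm L (hAC L hL)).1
    have h2 : m * L ∈ KS V := by
      refine KS_of_continuous hV (hcont _ h1) ?_
      rw [star_mul]
      exact KS_mul (hAK hL).2 _
    exact mem_closure_of_KS hV h2 fun e he => Submodule.subset_span ⟨e, he, m * L, rfl⟩
end
end

section
/- Let 𝓚 be a complex Hilbert space, 𝔘 ⊆ B(𝓚) a C*-subalgebra, and D ⊆ U(𝓚) a subgroup of the unitary group of 𝓚. Assume that the closed linear span L of {u·d : u ∈ 𝔘, d ∈ D} is a *-subalgebra of B(𝓚) and that the closed linear span of {u·ℓ : u ∈ 𝔘, ℓ ∈ L} equals L (𝔘 acts non-degenerately on L). Then for every C*-subalgebra A ⊆ B(𝓚), A·L is contained in the closed linear span of L·B(𝓚) if and only if A·𝔘 is contained in the closed linear span of 𝔘·B(𝓚). -/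
open MeasureTheory Filter

noncomputable section

variable {H : Type*} [NormedAddCommGroup H] [InnerProductSpace ℂ H] [CompleteSpace H]

/-- A continuous linear map sending the generators of a closed span into a closed submodule
sends the whole closed span there. -/
theorem map_closedSpan_mem (f : (H →L[ℂ] H) →L[ℂ] (H →L[ℂ] H)) (S T : Set (H →L[ℂ] H))
    (h : ∀ x ∈ S, f x ∈ closure (↑(Submodule.span ℂ T) : Set (H →L[ℂ] H)))
    (x : H →L[ℂ] H) (hx : x ∈ closure (↑(Submodule.span ℂ S) : Set (H →L[ℂ] H))) :
    f x ∈ closure (↑(Submodule.span ℂ T) : Set (H →L[ℂ] H)) := by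
  have h1 : Submodule.span ℂ S ≤
      ((Submodule.span ℂ T).topologicalClosure).comap (f : (H →L[ℂ] H) →ₗ[ℂ] (H →L[ℂ] H)) :=
    Submodule.span_le.2 h
  have h2 : IsClosed (f ⁻¹' closure (↑(Submodule.span ℂ T) : Set (H →L[ℂ] H))) :=
    isClosed_closure.preimage f.continuous
  exact closure_minimal (fun y hy => h1 hy) h2 hx

theorem closedRightSpan_mul_right (S : Set (H →L[ℂ] H)) (x B : H →L[ℂ] H)
    (hx : x ∈ closedRightSpan S) : x * B ∈ closedRightSpan S := by
  refine map_closedSpan_mem ((ContinuousLinearMap.mul ℂ (H →L[ℂ] H)).flip B) _ _ ?_ x hx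
  rintro y ⟨l, hl, C, rfl⟩
  exact subset_closure (Submodule.subset_span ⟨l, hl, C * B, by simp [mul_assoc]⟩)

theorem closedRightSpan_le (S T : Set (H →L[ℂ] H)) (h : S ⊆ closedRightSpan T) :
    closedRightSpan S ⊆ closedRightSpan T := by
  intro x hx
  refine map_closedSpan_mem (ContinuousLinearMap.id ℂ (H →L[ℂ] H)) _ _ ?_ x hx
  rintro y ⟨l, hl, C, rfl⟩
  exact closedRightSpan_mul_right T l C (h hl)

theorem subset_closedRightSpan (S : Set (H →L[ℂ] H)) : S ⊆ closedRightSpan S :=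
  fun x hx => subset_closure (Submodule.subset_span ⟨x, hx, 1, by simp⟩)

/-- If `L` is the closed span of `𝔘·D` for a C*-algebra `𝔘` and a group of
unitaries `D`, `L` is a *-algebra, and `𝔘` acts non-degenerately on `L`, then for any
C*-subalgebra `A`: `A·L ⊆ closed span (L·B(H))` iff `A·𝔘 ⊆ closed span (𝔘·B(H))`. -/
theorem cross_wrt_semidirect_host_iff_cross_wrt_subalgebra
    (𝔘 : NonUnitalStarSubalgebra ℂ (H →L[ℂ] H))
    (h𝔘 : IsClosed (𝔘 : Set (H →L[ℂ] H)))
    (D : Subgroup (unitary (H →L[ℂ] H)))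
    (L : Set (H →L[ℂ] H))
    (hL : L = closure (↑(Submodule.span ℂ
      {x : H →L[ℂ] H | ∃ u ∈ 𝔘, ∃ d ∈ D, x = u * (d : H →L[ℂ] H)}) : Set (H →L[ℂ] H)))
    (hLstar : ∀ x ∈ L, star x ∈ L)
    (hLmul : ∀ x ∈ L, ∀ y ∈ L, x * y ∈ L)
    (hnondeg : closure (↑(Submodule.span ℂ
      {x : H →L[ℂ] H | ∃ u ∈ 𝔘, ∃ l ∈ L, x = u * l}) : Set (H →L[ℂ] H)) = L)
    (A : NonUnitalStarSubalgebra ℂ (H →L[ℂ] H))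
    (hA : IsClosed (A : Set (H →L[ℂ] H))) :
    IsCrossRep (A : Set (H →L[ℂ] H)) L ↔
      IsCrossRep (A : Set (H →L[ℂ] H)) (𝔘 : Set (H →L[ℂ] H)) := by
  have hUL : (𝔘 : Set (H →L[ℂ] H)) ⊆ L := by
    intro u hu
    rw [hL]
    exact subset_closure (Submodule.subset_span ⟨u, hu, 1, D.one_mem, by simp⟩)
  have hLU : L ⊆ closedRightSpan (𝔘 : Set (H →L[ℂ] H)) := by
    rw [hL]
    refine closure_mono (Submodule.span_mono ?_)
    rintro y ⟨u, hu, d, _, rfl⟩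
    exact ⟨u, hu, d, rfl⟩
  constructor
  · intro h a ha u hu
    exact closedRightSpan_le _ _ hLU (h a ha u (hUL hu))
  · intro h a ha l hl
    refine closedRightSpan_le _ _ (hUL.trans (subset_closedRightSpan L)) ?_
    refine map_closedSpan_mem (ContinuousLinearMap.mul ℂ (H →L[ℂ] H) a) _ _ ?_ l (hLU hl)
    rintro y ⟨u, hu, C, rfl⟩
    have := closedRightSpan_mul_right _ _ C (h a ha u hu)
    rw [mul_assoc] at this
    exact this
end
end

section
/- On L²(ℝ) let U be the translation group, (U_t ψ)(x) = ψ(x+t); for r ∈ ℝ let M_r denote multiplication by x ↦ e^{irx}, and let 𝒜 be the C*-subalgebra of B(L²(ℝ)) generated by {M_r : r ∈ ℝ}. Let 𝓗² := {ψ ∈ L²(ℝ) : 𝓕ψ vanishes almost everywhere on (−∞,0)}, where 𝓕 is the Fourier–Plancherel transform. Then: (a) for every f ∈ L¹(ℝ) with ∫ f(t)e^{itλ} dt = 0 for all λ ≥ 0 and every ψ ∈ 𝓗², U(f)ψ = 0; consequently every operator in the closed linear span of 𝒜·𝔏₋ vanishes on 𝓗²; (b) there exist f ∈ L¹(ℝ)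 with ∫ f(t)e^{itλ} dt = 0 for all λ ≥ 0, r ∈ ℝ, and ψ ∈ 𝓗² such that U(f)M_r ψ ≠ 0. Consequently 𝔏₋·𝒜 is not contained in the closed linear span of 𝒜·𝔏₋. -/
open MeasureTheory Filter

noncomputable section

variable {H : Type*} [NormedAddCommGroup H] [InnerProductSpace ℂ H] [CompleteSpace H]

open scoped FourierTransform SchwartzMap

abbrev L2R : Type := Lp ℂ 2 (volume : Measure ℝ)

def TransHyp (τ : ℝ → L2R →L[ℂ] L2R) : Prop :=
  ∀ (t : ℝ) (ψ : L2R), (τ t ψ : ℝ → ℂ) =ᵐ[volume] fun x => (ψ : ℝ → ℂ) (x + t)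

def MulHyp (M : ℝ → L2R →L[ℂ] L2R) : Prop :=
  ∀ (r : ℝ) (ψ : L2R), (M r ψ : ℝ → ℂ) =ᵐ[volume]
        fun x => Complex.exp (Complex.I * (r : ℂ) * (x : ℂ)) * (ψ : ℝ → ℂ) x

def FourHyp (F : L2R →L[ℂ] L2R) (c : ℂ) : Prop :=
  ∀ ψ : L2R, Integrable (ψ : ℝ → ℂ) volume →
      (F ψ : ℝ → ℂ) =ᵐ[volume]
        fun ξ => c * ∫ x : ℝ, (ψ : ℝ → ℂ) x * Complex.exp (-(Complex.I * (ξ : ℂ) * (x : ℂ)))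

lemma trans_eq {τ : ℝ → L2R →L[ℂ] L2R} (hτ : TransHyp τ) (t : ℝ) (ψ : L2R) :
    τ t ψ = (DomAddAct.mk t) +ᵥ ψ := by
  apply Lp.ext
  refine (hτ t ψ).trans ?_
  refine EventuallyEq.trans ?_ (DomAddAct.vadd_Lp_ae_eq (DomAddAct.mk t) ψ).symm
  refine Eventually.of_forall fun x => ?_
  simp [add_comm]

lemma trans_cont {τ : ℝ → L2R →L[ℂ] L2R} (hτ : TransHyp τ) (ψ : L2R) :
    Continuous fun t => τ t ψ := by
  simp_rw [trans_eq hτ]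
  have : Fact ((2 : ENNReal) ≠ ⊤) := ⟨by simp⟩
  have h : Continuous (fun t : ℝ => DomAddAct.mk t) := DomAddAct.continuous_mk
  exact h.vadd continuous_const

lemma trans_norm {τ : ℝ → L2R →L[ℂ] L2R} (hτ : TransHyp τ) (t : ℝ) (ψ : L2R) :
    ‖τ t ψ‖ = ‖ψ‖ := by
  rw [trans_eq hτ, DomAddAct.norm_vadd_Lp]

lemma trans_int {τ : ℝ → L2R →L[ℂ] L2R} (hτ : TransHyp τ) {f : ℝ → ℂ} (hf : Integrable f)
    (ψ : L2R) : Integrable fun t => f t • τ t ψ := by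
  refine Integrable.mono' (hf.norm.mul_const ‖ψ‖)
    (hf.aestronglyMeasurable.smul (trans_cont hτ ψ).aestronglyMeasurable) ?_
  exact Eventually.of_forall fun t => by rw [norm_smul, trans_norm hτ]

lemma exists_intOp {τ : ℝ → L2R →L[ℂ] L2R} (hτ : TransHyp τ) {f : ℝ → ℂ} (hf : Integrable f) :
    ∃ T : L2R →L[ℂ] L2R, ∀ ψ, T ψ = ∫ t, f t • τ t ψ := by
  refine ⟨LinearMap.mkContinuous
    { toFun := fun ψ => ∫ t, f t • τ t ψ
      map_add' := fun a b => by
        simp_rw [map_add, smul_add]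
        exact integral_add (trans_int hτ hf a) (trans_int hτ hf b)
      map_smul' := fun z a => by
        simp_rw [map_smul, smul_comm (f _) z]
        exact integral_smul z _ } (∫ t, ‖f t‖) ?_, fun ψ => rfl⟩
  intro ψ
  refine (norm_integral_le_integral_norm _).trans (le_of_eq ?_)
  simp_rw [norm_smul, trans_norm hτ]
  exact integral_mul_const _ _

lemma dense_ext {P : L2R → Prop} (hcl : IsClosed {ψ | P ψ})
    (h : ∀ s : 𝓢(ℝ, ℂ), P (s.toLp 2 volume)) (ψ : L2R) : P ψ := by
  have hd : DenseRange (SchwartzMap.toLpCLM ℝ ℂ (E := ℝ) 2 volume) :=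
    SchwartzMap.denseRange_toLpCLM ENNReal.ofNat_ne_top
  exact hd.induction_on (p := P) ψ hcl (fun s => h s)

lemma four_ae {F : L2R →L[ℂ] L2R} {c : ℂ} (hF : FourHyp F c) (ψ : L2R) (g : ℝ → ℂ)
    (hg : Integrable g) (hψ : (ψ : ℝ → ℂ) =ᵐ[volume] g) :
    (F ψ : ℝ → ℂ) =ᵐ[volume] 
      fun ξ => c * ∫ x : ℝ, g x * Complex.exp (-(Complex.I * (ξ : ℂ) * (x : ℂ))) := by
  refine (hF ψ (hg.congr hψ.symm)).trans (Eventually.of_forall fun ξ => ?_)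
  dsimp only
  congr 1
  refine integral_congr_ae ?_
  filter_upwards [hψ] with x hx
  rw [hx]

lemma four_trans {τ M : ℝ → L2R →L[ℂ] L2R} (hτ : TransHyp τ) (hM : MulHyp M)
    {F : L2R →L[ℂ] L2R} {c : ℂ} (hF : FourHyp F c) (t : ℝ) (ψ : L2R) :
    F (τ t ψ) = M t (F ψ) := by
  refine dense_ext (P := fun ψ => F (τ t ψ) = M t (F ψ)) ?_ ?_ ψ
  · exact isClosed_eq (by fun_prop) (by fun_prop)
  intro s
  have hs := s.coeFn_toLp 2 (volume : Measure ℝ)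
  have hts : (τ t (s.toLp 2 volume) : ℝ → ℂ) =ᵐ[volume] fun x => s (x + t) := by
    refine (hτ t _).trans ?_
    exact (measurePreserving_add_right volume t).quasiMeasurePreserving.ae_eq hs
  apply Lp.ext
  filter_upwards [four_ae hF _ _ (s.integrable.comp_add_right t) hts, hM t (F (s.toLp 2 volume)),
    four_ae hF _ _ s.integrable hs] with ξ h1 h2 h3
  rw [h1, h2, h3, mul_left_comm]
  congr 1
  rw [← integral_const_mul, ← integral_add_right_eq_self (fun x : ℝ => Complex.exp (Complex.I * (t : ℂ) * (ξ : ℂ)) *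
      (s x * Complex.exp (-(Complex.I * (ξ : ℂ) * (x : ℂ))))) t]
  congr 1
  ext x
  rw [mul_left_comm, ← Complex.exp_add]
  congr 2
  push_cast
  ring

lemma four_eq (g : ℝ → ℂ) (ξ : ℝ) :
    ∫ x : ℝ, g x * Complex.exp (-(Complex.I * (ξ : ℂ) * (x : ℂ))) =
      𝓕 g (ξ / (2 * Real.pi)) := by
  rw [Real.fourier_real_eq_integral_exp_smul]
  congr 1
  ext x
  rw [smul_eq_mul, mul_comm]
  congr 2
  push_cast
  have : (Real.pi : ℂ) ≠ 0 := by exact_mod_cast Real.pi_ne_zero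
  field_simp

lemma norm_sq_L2 (ψ : L2R) : ‖ψ‖ ^ 2 = ∫ x, ‖(ψ : ℝ → ℂ) x‖ ^ 2 := by
  have h := L2.inner_def (𝕜 := ℂ) ψ ψ
  simp_rw [inner_self_eq_norm_sq_to_K] at h
  apply Complex.ofReal_injective
  rw [← integral_complex_ofReal]
  push_cast
  exact h

lemma four_norm {F : L2R →L[ℂ] L2R} {c : ℂ} (hF : FourHyp F c) (ψ : L2R) :
    ‖F ψ‖ ^ 2 = ‖c‖ ^ 2 * (2 * Real.pi) * ‖ψ‖ ^ 2 := by
  refine dense_ext (P := fun ψ => ‖F ψ‖ ^ 2 = ‖c‖ ^ 2 * (2 * Real.pi) * ‖ψ‖ ^ 2) ?_ ?_ ψ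
  · exact isClosed_eq (by fun_prop) (by fun_prop)
  intro s
  have hs := s.coeFn_toLp 2 (volume : Measure ℝ)
  rw [norm_sq_L2, norm_sq_L2]
  have e1 : ∫ x, ‖(s.toLp 2 volume : ℝ → ℂ) x‖ ^ 2 = ∫ x, ‖s x‖ ^ 2 := by
    refine integral_congr_ae ?_
    filter_upwards [hs] with x hx
    rw [hx]
  have e2 : ∫ x, ‖(F (s.toLp 2 volume) : ℝ → ℂ) x‖ ^ 2
      = ∫ x, ‖c‖ ^ 2 * (fun y => ‖𝓕 s y‖ ^ 2) (x / (2 * Real.pi)) := by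
    refine integral_congr_ae ?_
    filter_upwards [four_ae hF _ _ s.integrable hs] with x hx
    rw [hx, four_eq, norm_mul, mul_pow, SchwartzMap.fourier_coe]
  rw [e1, e2, integral_const_mul, Measure.integral_comp_div (fun y => ‖𝓕 s y‖ ^ 2),
    SchwartzMap.integral_norm_sq_fourier,
    abs_of_pos Real.two_pi_pos, smul_eq_mul]
  ring

lemma four_inj {F : L2R →L[ℂ] L2R} {c : ℂ} (hc : c ≠ 0) (hF : FourHyp F c) (ψ : L2R)
    (h : F ψ = 0) : ψ = 0 := by
  have := four_norm hF ψ
  rw [h] at this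
  have h2 : ‖c‖ ^ 2 * (2 * Real.pi) ≠ 0 := by
    have := norm_pos_iff.2 hc
    have := Real.pi_pos
    positivity
  simpa [h2, hc, Real.pi_ne_zero] using this

lemma inner_four {τ M : ℝ → L2R →L[ℂ] L2R} (hτ : TransHyp τ) (hM : MulHyp M)
    {F : L2R →L[ℂ] L2R} {c : ℂ} (hF : FourHyp F c) {f : ℝ → ℂ} (hf : Integrable f) (g χ : L2R) :
    inner ℂ g (F (∫ t, f t • τ t χ)) =
      ∫ x : ℝ, inner ℂ ((g : ℝ → ℂ) x) ((F χ : ℝ → ℂ) x) *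
        ∫ t : ℝ, f t * Complex.exp (Complex.I * (t : ℂ) * (x : ℂ)) := by
  rw [← F.integral_comp_comm (trans_int hτ hf χ),
    ← integral_inner (F.integrable_comp (trans_int hτ hf χ))]
  have hprod : Integrable (Function.uncurry fun (t x : ℝ) =>
      inner ℂ ((g : ℝ → ℂ) x) ((F χ : ℝ → ℂ) x) *
        (f t * Complex.exp (Complex.I * (t : ℂ) * (x : ℂ)))) (volume.prod volume) := by
    have h1 : Integrable (fun p : ℝ × ℝ => f p.1 * inner ℂ ((g : ℝ → ℂ) p.2) ((F χ : ℝ → ℂ) p.2))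
        (volume.prod volume) := hf.mul_prod (L2.integrable_inner (𝕜 := ℂ) g (F χ))
    have hc : Continuous (fun p : ℝ × ℝ => Complex.exp (Complex.I * (p.1 : ℂ) * (p.2 : ℂ))) := by
      fun_prop
    have h2 := h1.mul_bdd (c := 1) hc.aestronglyMeasurable (Eventually.of_forall fun p => by
      rw [Complex.norm_exp]; simp)
    refine h2.congr (Eventually.of_forall fun p => ?_)
    simp only [Function.uncurry]
    ring
  simp_rw [← integral_const_mul]
  rw [← integral_integral_swap hprod]
  congr 1
  ext t
  rw [map_smul, inner_smul_right, four_trans hτ hM hF, L2.inner_def, ← integral_const_mul]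
  refine integral_congr_ae ?_
  filter_upwards [hM t (F χ)] with x hx
  rw [hx, ← smul_eq_mul (Complex.exp _), inner_smul_right]
  ring

lemma part_a {τ M : ℝ → L2R →L[ℂ] L2R} (hτ : TransHyp τ) (hM : MulHyp M)
    {F : L2R →L[ℂ] L2R} {c : ℂ} (hc : c ≠ 0) (hF : FourHyp F c) {f : ℝ → ℂ}
    (hf : NegSpectralFun f) (ψ : L2R) (hψ : ∀ᵐ x : ℝ, x < 0 → (F ψ : ℝ → ℂ) x = 0) :
    ∫ t, f t • τ t ψ = 0 := by
  apply four_inj hc hF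
  apply ext_inner_left ℂ
  intro g
  rw [inner_four hτ hM hF hf.1, inner_zero_right]
  apply integral_eq_zero_of_ae
  filter_upwards [hψ] with x hx
  rcases lt_or_ge x 0 with h | h
  · simp [hx h]
  · simp [hf.2 x h]

lemma exists_bump : ∃ b : 𝓢(ℝ, ℂ), ∃ β : ℝ → ℝ, (∀ x, b x = (β x : ℂ)) ∧ Continuous β ∧
    HasCompactSupport β ∧ (∀ x, 0 ≤ β x) ∧ β (3/2) = 1 ∧ ∀ x ≤ 0, β x = 0 := by
  let B : ContDiffBump (3/2 : ℝ) := ⟨1/8, 1/4, by norm_num, by norm_num⟩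
  have h1 : HasCompactSupport (fun x => (B x : ℂ)) :=
    B.hasCompactSupport.comp_left (g := fun x : ℝ => (x : ℂ)) (by simp)
  have h2 : ContDiff ℝ (⊤ : ℕ∞) (fun x => (B x : ℂ)) :=
    Complex.ofRealCLM.contDiff.comp B.contDiff
  refine ⟨h1.toSchwartzMap h2, B, fun x => rfl, B.continuous, B.hasCompactSupport,
    fun x => B.nonneg, ?_, ?_⟩
  · exact B.one_of_mem_closedBall (Metric.mem_closedBall_self (by norm_num))
  · intro x hx
    apply B.zero_of_le_dist
    rw [Real.dist_eq, abs_sub_comm, abs_of_nonneg (by linarith)]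
    change (1/4 : ℝ) ≤ _
    linarith

lemma part_b {τ M : ℝ → L2R →L[ℂ] L2R} (hτ : TransHyp τ) (hM : MulHyp M)
    {F : L2R →L[ℂ] L2R} {c : ℂ} (hc : c ≠ 0) (hF : FourHyp F c) :
    ∃ (f : ℝ → ℂ) (r : ℝ) (ψ : L2R), NegSpectralFun f ∧
      (∀ᵐ x : ℝ, x < 0 → (F ψ : ℝ → ℂ) x = 0) ∧ ∫ t, f t • τ t (M r ψ) ≠ 0 := by
  obtain ⟨b, β, hb, hβc, hβs, hβ0, hβ1, hβn⟩ := exists_bump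
  have hpi := Real.pi_pos
  let s : 𝓢(ℝ, ℂ) := 𝓕⁻ b
  have hs : 𝓕 (s : ℝ → ℂ) = b := by
    rw [← SchwartzMap.fourier_coe]; simp [s]
  have hE : ∀ l : ℝ, ∫ t : ℝ, s t * Complex.exp (Complex.I * (t : ℂ) * (l : ℂ))
      = (β (-l / (2 * Real.pi)) : ℂ) := by
    intro l
    rw [← hb, ← hs, ← four_eq]
    congr 1
    ext x
    congr 2
    push_cast
    ring
  have hsL := s.coeFn_toLp 2 (volume : Measure ℝ)
  refine ⟨s, -(6 * Real.pi), s.toLp 2 volume, ⟨s.integrable, fun l hl => ?_⟩, ?_, ?_⟩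
  · rw [hE, hβn _ (div_nonpos_of_nonpos_of_nonneg (by linarith) (by positivity))]
    simp
  · filter_upwards [four_ae hF _ _ s.integrable hsL] with x hx h
    rw [hx, four_eq, hs, hb, hβn _ (div_nonpos_of_nonpos_of_nonneg h.le (by positivity))]
    simp
  · intro h0
    set χ := M (-(6 * Real.pi)) (s.toLp 2 volume) with hχ
    have hI := inner_four hτ hM hF s.integrable (F χ) χ
    rw [h0, map_zero, inner_zero_right] at hI
    have hm : (χ : ℝ → ℂ) =ᵐ[volume]
        fun x => Complex.exp (Complex.I * ((-(6 * Real.pi) : ℝ) : ℂ) * (x : ℂ)) * s x := by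
      filter_upwards [hM (-(6 * Real.pi)) (s.toLp 2 volume), hsL] with x h1 h2
      rw [hχ, h1, h2]
    have hmi : Integrable
        fun x : ℝ => Complex.exp (Complex.I * ((-(6 * Real.pi) : ℝ) : ℂ) * (x : ℂ)) * s x := by
      refine s.integrable.bdd_mul (c := 1) (Continuous.aestronglyMeasurable (by fun_prop))
        (Eventually.of_forall fun p => by
          rw [Complex.norm_exp]; simp)
    have hFχ := four_ae hF _ _ hmi hm
    have hFχ' : ∀ᵐ x : ℝ, (F χ : ℝ → ℂ) x = c * (β (x / (2 * Real.pi) + 3) : ℂ) := by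
      filter_upwards [hFχ] with x hx
      rw [hx, ← hb, ← hs]
      have : x / (2 * Real.pi) + 3 = (x + 6 * Real.pi) / (2 * Real.pi) := by
        field_simp
        ring
      rw [this, ← four_eq]
      congr 2
      ext y
      rw [mul_comm (Complex.exp _), mul_assoc, ← Complex.exp_add]
      congr 2
      push_cast
      ring
    let G : ℝ → ℝ := fun x => ‖c‖ ^ 2 * β (x / (2 * Real.pi) + 3) ^ 2 * β (-x / (2 * Real.pi))
    have hG : ∫ x, G x = 0 := by
      apply Complex.ofReal_injective
      rw [← integral_complex_ofReal, Complex.ofReal_zero, hI]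
      refine integral_congr_ae ?_
      filter_upwards [hFχ'] with x hx
      rw [hx, hE, inner_self_eq_norm_sq_to_K]
      simp [G, mul_pow]
      left
      norm_cast
      simp
    have hGc : Continuous G := by fun_prop
    have hGs : HasCompactSupport G := by
      apply HasCompactSupport.mul_left
      have hne : -(2 * Real.pi)⁻¹ ≠ 0 := neg_ne_zero.2 (inv_ne_zero Real.two_pi_pos.ne')
      have := hβs.comp_homeomorph (Homeomorph.mulRight₀ (-(2 * Real.pi)⁻¹) hne)
      have he : (fun x : ℝ => β (-x / (2 * Real.pi)))
          = β ∘ (Homeomorph.mulRight₀ (-(2 * Real.pi)⁻¹) hne) := by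
        ext x
        simp [div_eq_mul_inv]
      exact he ▸ this
    have hpos := hGc.integral_pos_of_hasCompactSupport_nonneg_nonzero (μ := volume) (x := -(3 * Real.pi)) hGs
      (fun x => by have := hβ0 (-x / (2 * Real.pi)); simp only [Pi.zero_apply, G]; positivity) (by
        have e1 : -(3 * Real.pi) / (2 * Real.pi) + 3 = 3/2 := by field_simp; ring
        have e2 : -(-(3 * Real.pi)) / (2 * Real.pi) = 3/2 := by field_simp
        simp only [G, e1, e2, hβ1]
        simpa using hc)
    exact hpos.ne' hG

lemma closure_span_kill {S : Set (L2R →L[ℂ] L2R)} {ψ : L2R} (h : ∀ T ∈ S, T ψ = 0) :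
    ∀ T ∈ closure (↑(Submodule.span ℂ S) : Set (L2R →L[ℂ] L2R)), T ψ = 0 := by
  have hcl : IsClosed {T : L2R →L[ℂ] L2R | T ψ = 0} :=
    isClosed_eq (by fun_prop) continuous_const
  refine closure_minimal ?_ hcl
  intro T hT
  change T ψ = 0
  induction hT using Submodule.span_induction with
  | mem x hx => exact h x hx
  | zero => rfl
  | add x y _ _ hx hy => rw [ContinuousLinearMap.add_apply, hx, hy, add_zero]
  | smul a x _ hx => rw [ContinuousLinearMap.smul_apply, hx, smul_zero]

/-- For the translation group `τ` on `L²(ℝ)` and the C*-algebra `𝒜`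
generated by the multiplication operators `M_r : ψ ↦ e^{irx}ψ`: (a) every `U(f)` with `f`
of negative type kills the Hardy space `𝓗²`, hence so does every operator in the closed
span of `𝒜·𝔏₋`; (b) some `U(f)·M_r` does not kill `𝓗²`; consequently `𝔏₋·𝒜` is not
contained in the closed span of `𝒜·𝔏₋`. -/
theorem neg_ideal_condition_fails_for_translations
    (τ : ℝ → (Lp ℂ 2 (volume : Measure ℝ) →L[ℂ] Lp ℂ 2 (volume : Measure ℝ)))
    (hτ : ∀ (t : ℝ) (ψ : Lp ℂ 2 (volume : Measure ℝ)),
      (τ t ψ : ℝ → ℂ) =ᵐ[(volume : Measure ℝ)] fun x => (ψ : ℝ → ℂ) (x + t))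
    (Mfam : ℝ → (Lp ℂ 2 (volume : Measure ℝ) →L[ℂ] Lp ℂ 2 (volume : Measure ℝ)))
    (hMfam : ∀ (r : ℝ) (ψ : Lp ℂ 2 (volume : Measure ℝ)),
      (Mfam r ψ : ℝ → ℂ) =ᵐ[(volume : Measure ℝ)]
        fun x => Complex.exp (Complex.I * (r : ℂ) * (x : ℂ)) * (ψ : ℝ → ℂ) x)
    (F : Lp ℂ 2 (volume : Measure ℝ) →L[ℂ] Lp ℂ 2 (volume : Measure ℝ))
    (c : ℂ) (hc : c ≠ 0)
    (hF : ∀ ψ : Lp ℂ 2 (volume : Measure ℝ), Integrable (ψ : ℝ → ℂ) (volume : Measure ℝ) →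
      (F ψ : ℝ → ℂ) =ᵐ[(volume : Measure ℝ)]
        fun ξ => c * ∫ x : ℝ, (ψ : ℝ → ℂ) x * Complex.exp (-(Complex.I * (ξ : ℂ) * (x : ℂ))))
    (𝒜 : Set (Lp ℂ 2 (volume : Measure ℝ) →L[ℂ] Lp ℂ 2 (volume : Measure ℝ)))
    (h𝒜 : 𝒜 = closure (↑(NonUnitalStarAlgebra.adjoin ℂ (Set.range Mfam)) :
      Set (Lp ℂ 2 (volume : Measure ℝ) →L[ℂ] Lp ℂ 2 (volume : Measure ℝ))))
    (H2 : Set (Lp ℂ 2 (volume : Measure ℝ)))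
    (hH2 : H2 = {ψ : Lp ℂ 2 (volume : Measure ℝ) |
      ∀ᵐ x ∂(volume : Measure ℝ), x < 0 → (F ψ : ℝ → ℂ) x = 0}) :
    -- (a)
    ((∀ f : ℝ → ℂ, NegSpectralFun f → ∀ ψ ∈ H2, (∫ t : ℝ, f t • τ t ψ) = 0) ∧
      (∀ T ∈ closure (↑(Submodule.span ℂ
          {x : Lp ℂ 2 (volume : Measure ℝ) →L[ℂ] Lp ℂ 2 (volume : Measure ℝ) |
            ∃ a ∈ 𝒜, ∃ L ∈ negPartAlgebra τ, x = a * L}) :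
          Set (Lp ℂ 2 (volume : Measure ℝ) →L[ℂ] Lp ℂ 2 (volume : Measure ℝ))),
        ∀ ψ ∈ H2, T ψ = 0)) ∧
    -- (b)
    ((∃ (f : ℝ → ℂ) (r : ℝ) (ψ : Lp ℂ 2 (volume : Measure ℝ)),
        NegSpectralFun f ∧ ψ ∈ H2 ∧ (∫ t : ℝ, f t • τ t (Mfam r ψ)) ≠ 0) ∧
      ¬ (∀ L ∈ negPartAlgebra τ, ∀ a ∈ 𝒜, L * a ∈ closure (↑(Submodule.span ℂ
          {x : Lp ℂ 2 (volume : Measure ℝ) →L[ℂ] Lp ℂ 2 (volume : Measure ℝ) |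
            ∃ a' ∈ 𝒜, ∃ L' ∈ negPartAlgebra τ, x = a' * L'}) :
          Set (Lp ℂ 2 (volume : Measure ℝ) →L[ℂ] Lp ℂ 2 (volume : Measure ℝ))))) := by
  have hτ' : TransHyp τ := hτ
  have hM' : MulHyp Mfam := hMfam
  have hF' : FourHyp F c := hF
  have ha : ∀ f : ℝ → ℂ, NegSpectralFun f → ∀ ψ ∈ H2, (∫ t : ℝ, f t • τ t ψ) = 0 := by
    intro f hf ψ hψ
    rw [hH2] at hψ
    exact part_a hτ' hM' hc hF' hf ψ hψ
  have ha2 : ∀ T ∈ closure (↑(Submodule.span ℂ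
          {x : Lp ℂ 2 (volume : Measure ℝ) →L[ℂ] Lp ℂ 2 (volume : Measure ℝ) |
            ∃ a ∈ 𝒜, ∃ L ∈ negPartAlgebra τ, x = a * L}) :
          Set (Lp ℂ 2 (volume : Measure ℝ) →L[ℂ] Lp ℂ 2 (volume : Measure ℝ))),
        ∀ ψ ∈ H2, T ψ = 0 := by
    intro T hT ψ hψ
    refine closure_span_kill ?_ T hT
    rintro _ ⟨a, -, L, hL, rfl⟩
    have : L ψ = 0 := by
      refine closure_span_kill ?_ L hL
      rintro T ⟨f, hf, hTf⟩
      exact (hTf ψ).trans (ha f hf ψ hψ)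
    simp [this]
  obtain ⟨f, r, ψ, hf, hψ, hne⟩ := part_b hτ' hM' hc hF'
  have hψ2 : ψ ∈ H2 := by rw [hH2]; exact hψ
  refine ⟨⟨ha, ha2⟩, ⟨f, r, ψ, hf, hψ2, hne⟩, fun hall => ?_⟩
  obtain ⟨T, hT⟩ := exists_intOp hτ' hf.1
  have hTm : T ∈ negPartAlgebra τ := subset_closure (Submodule.subset_span ⟨f, hf, hT⟩)
  have hMm : Mfam r ∈ 𝒜 := by
    rw [h𝒜]
    exact subset_closure (NonUnitalStarAlgebra.subset_adjoin ℂ _ ⟨r, rfl⟩)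
  have := ha2 _ (hall T hTm _ hMm) ψ hψ2
  apply hne
  rw [← hT]
  exact this
end
end

section
/- Let 𝓗 be a complex Hilbert space, π : C₀(ℝ) → B(𝓗) a non-degenerate *-homomorphism (the linear span of {π(f)ψ : f ∈ C₀(ℝ), ψ ∈ 𝓗} is dense in 𝓗), and U : ℝ → U(𝓗) a strongly continuous one-parameter unitary group with non-negative spectrum satisfying the covariance relation U_t π(f) U_t⁻¹ = π(x ↦ f(x+t)) for all f ∈ C₀(ℝ) and t ∈ ℝ. Then 𝓗 = {0}; i.e. the translation action of ℝ on C₀(ℝ) admits no non-trivial positive covariant representation. -/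
open MeasureTheory Filter

noncomputable section

variable {H : Type*} [NormedAddCommGroup H] [InnerProductSpace ℂ H] [CompleteSpace H]

open scoped FourierTransform Topology ContDiff in
lemma aux_differentiable (h : ℝ → ℂ) (hc : Continuous h) (hs : HasCompactSupport h) :
    Differentiable ℂ fun z : ℂ => ∫ t : ℝ, Complex.exp (-2 * Real.pi * Complex.I * t * z) * h t := by
  intro z₀
  have key := hasDerivAt_integral_of_dominated_loc_of_deriv_le (μ := (volume : Measure ℝ))
    (F := fun (z : ℂ) (t : ℝ) => Complex.exp (-2 * Real.pi * Complex.I * t * z) * h t)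
    (F' := fun (z : ℂ) (t : ℝ) => Complex.exp (-2 * Real.pi * Complex.I * t * z) *
      (-2 * Real.pi * Complex.I * t) * h t)
    (bound := fun t : ℝ => Real.exp (2 * Real.pi * |t| * (‖z₀‖ + 1)) * (2 * Real.pi * |t|) * ‖h t‖)
    (x₀ := z₀) (s := Metric.ball z₀ 1) (Metric.ball_mem_nhds _ one_pos) ?_ ?_ ?_ ?_ ?_ ?_
  · exact key.2.differentiableAt
  · exact Eventually.of_forall fun z => (by fun_prop : Continuous _).aestronglyMeasurable
  · exact Continuous.integrable_of_hasCompactSupport (by fun_prop) hs.mul_left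
  · exact (by fun_prop : Continuous _).aestronglyMeasurable
  · refine Eventually.of_forall fun t z hz => ?_
    have hz' : ‖z‖ ≤ ‖z₀‖ + 1 := by
      have h1 := norm_le_norm_add_norm_sub' z z₀
      rw [mem_ball_iff_norm] at hz
      linarith
    have hn : ‖(-2 * Real.pi * Complex.I * t : ℂ)‖ = 2 * Real.pi * |t| := by
      simp [abs_of_pos Real.pi_pos]
    rw [norm_mul, norm_mul, hn]
    gcongr
    refine (Complex.norm_exp_le_exp_norm _).trans ?_
    rw [norm_mul, hn]
    gcongr
  · exact Continuous.integrable_of_hasCompactSupport (by fun_prop) hs.norm.mul_left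
  · refine Eventually.of_forall fun t z _ => ?_
    have := ((hasDerivAt_id z).const_mul (-2 * Real.pi * Complex.I * t : ℂ)).cexp.mul_const (h t)
    simpa using this

open scoped FourierTransform Topology ContDiff in
lemma aux_negSpectral (φ : SchwartzMap ℝ ℂ) (hφ : ∀ x, 0 ≤ x → φ x = 0) :
    NegSpectralFun (𝓕 (φ : ℝ → ℂ)) := by
  rw [← SchwartzMap.fourier_coe]
  refine ⟨(𝓕 φ).integrable, fun l hl => ?_⟩
  have h1 : 𝓕⁻ (𝓕 (φ : ℝ → ℂ)) (l / (2 * Real.pi)) = φ (l / (2 * Real.pi)) := by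
    rw [φ.continuous.fourierInv_fourier_eq φ.integrable]
    rw [← SchwartzMap.fourier_coe]
    exact (𝓕 φ).integrable
  rw [hφ _ (by positivity), Real.fourierInv_eq', ← SchwartzMap.fourier_coe] at h1
  rw [← h1]
  congr 1
  ext t
  rw [smul_eq_mul, mul_comm]
  congr 2
  have := Real.pi_ne_zero
  simp
  field_simp

open scoped FourierTransform Topology ContDiff in
lemma aux_scalar (h : ℝ → ℂ) (hc : Continuous h) (hs : HasCompactSupport h)
    (hz : ∀ f, NegSpectralFun f → ∫ t, f t * h t = 0) : h = 0 := by
  have hi : Integrable h := hc.integrable_of_hasCompactSupport hs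
  set E : ℂ → ℂ := fun z : ℂ => ∫ t : ℝ, Complex.exp (-2 * Real.pi * Complex.I * t * z) * h t with hE
  have hEd : Differentiable ℂ E := aux_differentiable h hc hs
  have hEF : ∀ x : ℝ, 𝓕 h x = E x := by
    intro x
    rw [Real.fourier_real_eq_integral_exp_smul]
    congr 1
    ext t
    rw [smul_eq_mul]
    congr 2
    push_cast
    ring
  have hFc : Continuous (𝓕 h) := by
    have : 𝓕 h = fun x : ℝ => E x := funext hEF
    rw [this]
    exact hEd.continuous.comp Complex.continuous_ofReal
  have hae : ∀ᵐ x : ℝ, x ∈ Set.Iio (0 : ℝ) → 𝓕 h x = 0 := by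
    refine isOpen_Iio.ae_eq_zero_of_integral_contDiff_smul_eq_zero
      (hFc.locallyIntegrable.locallyIntegrableOn _) fun g hg hgs hgt => ?_
    have hgs' : HasCompactSupport (fun x => (g x : ℂ)) :=
      hgs.comp_left (g := fun r : ℝ => (r : ℂ)) Complex.ofReal_zero
    let φ : SchwartzMap ℝ ℂ := hgs'.toSchwartzMap (Complex.ofRealCLM.contDiff.comp hg)
    have hφ : ∀ x, φ x = g x := fun x => rfl
    have hn := hz _ (aux_negSpectral φ (fun x hx => by
      rw [hφ]
      by_contra hne
      have : x ∈ tsupport g := subset_tsupport _ (by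
        intro h0; apply hne; simp [h0])
      exact absurd (hgt this) (by simpa using hx)))
    have hfl := VectorFourier.integral_fourierIntegral_smul_eq_flip (μ := (volume : Measure ℝ))
      (ν := (volume : Measure ℝ)) (L := innerₗ ℝ) (f := (φ : ℝ → ℂ)) (g := h)
      Real.continuous_fourierChar continuous_inner φ.integrable hi
    rw [flip_innerₗ] at hfl
    calc ∫ x, g x • 𝓕 h x = ∫ x, φ x • 𝓕 h x := by
          congr 1
      _ = _ := hfl.symm
      _ = 0 := hn
  have hneg : ∀ x : ℝ, x < 0 → E x = 0 := by
    intro x hx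
    rw [← hEF]
    have h1 : Set.EqOn (𝓕 h) (fun _ => 0) (Set.Iio (0:ℝ)) := by
      refine Measure.eqOn_open_of_ae_eq (μ := volume) ?_ isOpen_Iio hFc.continuousOn
        continuousOn_const
      rw [EventuallyEq, ae_restrict_iff' measurableSet_Iio]
      exact hae
    exact h1 hx
  have hE0 : E = 0 := by
    have hA : AnalyticOnNhd ℂ E Set.univ := fun z _ => hEd.analyticAt z
    refine hA.eq_of_frequently_eq (z₀ := (-1 : ℂ)) (fun z _ => analyticAt_const) ?_
    have ht : Tendsto (fun x : ℝ => (x : ℂ)) (𝓝[<] (-1)) (𝓝[≠] (-1)) := by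
      refine tendsto_nhdsWithin_iff.2 ⟨?_, ?_⟩
      · have := (Complex.continuous_ofReal.tendsto (-1)).mono_left
          (nhdsWithin_le_nhds (s := Set.Iio (-1 : ℝ)))
        simpa using this
      · filter_upwards [self_mem_nhdsWithin] with x hx
        simp only [Set.mem_compl_iff, Set.mem_singleton_iff]
        intro h0
        have : x = -1 := by exact_mod_cast h0
        exact absurd hx (by simp [this])
    refine ht.frequently (Eventually.frequently ?_)
    filter_upwards [self_mem_nhdsWithin] with x hx
    have : x < -1 := hx
    exact hneg x (by linarith)
  have hF0 : 𝓕 h = 0 := by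
    ext x
    rw [hEF, hE0]
    rfl
  have hinv := hc.fourierInv_fourier_eq hi (by rw [hF0]; exact integrable_zero _ _ _)
  rw [← hinv, hF0]
  ext x
  simp [Real.fourierInv_eq']

open scoped ZeroAtInfty Topology InnerProductSpace in
lemma aux_compact (π : C₀(ℝ, ℂ) →⋆ₙₐ[ℂ] (H →L[ℂ] H))
    (U : ℝ → H →L[ℂ] H) (hU : IsUnitaryOneParam U)
    (hpos : HasNonnegSpectrum U)
    (hcov : ∀ (f g : C₀(ℝ, ℂ)) (t : ℝ), (∀ x : ℝ, g x = f (x + t)) →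
      U t * π f * star (U t) = π g) (f : C₀(ℝ, ℂ)) (hf : HasCompactSupport f) (ψ : H) :
    π f ψ = 0 := by
  obtain ⟨hun, hadd, hcont⟩ := hU
  have h0 : U 0 = 1 := by
    have h1 := hadd 0 0
    rw [add_zero] at h1
    have h2 := (Unitary.mem_iff.1 (hun 0)).1
    calc U 0 = (star (U 0) * U 0) * U 0 := by rw [h2, one_mul]
      _ = star (U 0) * U 0 := by rw [mul_assoc, ← h1]
      _ = 1 := h2
  let h : ℝ → ℂ := fun t => ⟪π f ψ, U t (π f ψ)⟫_ℂ
  have hc : Continuous h := continuous_const.inner (hcont _)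
  obtain ⟨R, hR⟩ := hf.isCompact.isBounded.exists_norm_le
  have hRf : ∀ x, f x ≠ 0 → |x| ≤ R := fun x hx => hR x (subset_tsupport _ hx)
  have hs : HasCompactSupport h := by
    refine HasCompactSupport.intro (isCompact_Icc (a := -(2 * R)) (b := 2 * R)) fun t ht => ?_
    let g : C₀(ℝ, ℂ) := f.comp ((Homeomorph.addRight t).toCocompactMap)
    have hg : ∀ x, g x = f (x + t) := fun x => rfl
    have hfg : star f * g = 0 := by
      ext x
      simp only [ZeroAtInftyContinuousMap.mul_apply, ZeroAtInftyContinuousMap.star_apply, hg,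
        ZeroAtInftyContinuousMap.zero_apply]
      by_contra hne
      have h1 : f x ≠ 0 := fun h => hne (by simp [h])
      have h2 : f (x + t) ≠ 0 := fun h => hne (by simp [h])
      have h3 := abs_le.1 (hRf _ h1)
      have h4 := abs_le.1 (hRf _ h2)
      exact ht ⟨by linarith, by linarith⟩
    have h1 : U t * π f = π g * U t := by
      rw [← hcov f g t hg, mul_assoc, mul_assoc, (Unitary.mem_iff.1 (hun t)).1, mul_one]
    have h2 : U t (π f ψ) = π g (U t ψ) := DFunLike.congr_fun h1 ψ
    change ⟪π f ψ, U t (π f ψ)⟫_ℂ = 0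
    rw [h2, ← ContinuousLinearMap.adjoint_inner_right, ← ContinuousLinearMap.star_eq_adjoint,
      ← map_star, ← mul_apply_eq_comp, ← map_mul, hfg]
    simp
  have hh := aux_scalar h hc hs fun k hk => by
    have h1 := hpos k hk (π f ψ)
    have hki : Integrable fun t => k t • U t (π f ψ) := by
      refine Integrable.mono' (hk.1.norm.mul_const ‖π f ψ‖)
        (hk.1.aestronglyMeasurable.smul (hcont _).aestronglyMeasurable)
        (Eventually.of_forall fun t => ?_)
      rw [norm_smul]
      gcongr
      exact (ContinuousLinearMap.norm_map_of_mem_unitary (hun t) _).le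
    have h2 := integral_inner (𝕜 := ℂ) hki (π f ψ)
    rw [h1, inner_zero_right] at h2
    rw [← h2]
    congr 1
    ext t
    rw [inner_smul_right]
  have h1 : h 0 = 0 := by rw [hh]; rfl
  simpa [h, h0] using h1

open scoped ZeroAtInfty Topology in
lemma aux_dense (f : C₀(ℝ, ℂ)) (ε : ℝ) (hε : 0 < ε) :
    ∃ g : C₀(ℝ, ℂ), HasCompactSupport g ∧ ‖f - g‖ ≤ ε := by
  have h1 : ∀ᶠ x in cocompact ℝ, ‖f x‖ < ε := by
    have := (zero_at_infty f).norm
    rw [norm_zero] at this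
    exact this.eventually_lt_const hε
  obtain ⟨K, hK, hKf⟩ := mem_cocompact.1 h1
  obtain ⟨χ, hχ1, -, hχs, hχ⟩ := exists_continuous_one_zero_of_isCompact hK isClosed_empty
    (Set.disjoint_empty K)
  have hgs : HasCompactSupport fun x => (χ x : ℂ) * f x :=
    (hχs.comp_left (g := fun r : ℝ => (r : ℂ)) Complex.ofReal_zero).mul_right
  let g : C₀(ℝ, ℂ) := ⟨⟨fun x => (χ x : ℂ) * f x, by fun_prop⟩, hgs.is_zero_at_infty⟩
  refine ⟨g, hgs, ?_⟩
  rw [← ZeroAtInftyContinuousMap.norm_toBCF_eq_norm,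
    BoundedContinuousFunction.norm_le hε.le]
  intro x
  change ‖f x - (χ x : ℂ) * f x‖ ≤ ε
  by_cases hx : x ∈ K
  · have : χ x = 1 := hχ1 hx
    simp [this, hε.le]
  · have h2 : ‖f x‖ < ε := hKf hx
    have h3 : f x - (χ x : ℂ) * f x = ((1 - χ x : ℝ) : ℂ) * f x := by push_cast; ring
    rw [h3, norm_mul, Complex.norm_real, Real.norm_of_nonneg (by linarith [(hχ x).2])]
    nlinarith [(hχ x).1, norm_nonneg (f x)]

open ZeroAtInfty in
/-- The translation action of `ℝ` on `C₀(ℝ)` admits no non-trivial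
positive covariant representation: if `π` is non-degenerate and covariant for a
one-parameter unitary group `U` with non-negative spectrum, then `H = {0}`. -/
theorem no_nontrivial_positive_covariant_rep_of_translations
    (π : C₀(ℝ, ℂ) →⋆ₙₐ[ℂ] (H →L[ℂ] H))
    (hnd : Dense (↑(Submodule.span ℂ
      {v : H | ∃ (f : C₀(ℝ, ℂ)) (ψ : H), v = π f ψ}) : Set H))
    (U : ℝ → H →L[ℂ] H) (hU : IsUnitaryOneParam U)
    (hpos : HasNonnegSpectrum U)
    (hcov : ∀ (f g : C₀(ℝ, ℂ)) (t : ℝ), (∀ x : ℝ, g x = f (x + t)) →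
      U t * π f * star (U t) = π g) :
    ∀ v : H, v = 0 := by
  have hz : ∀ (f : C₀(ℝ, ℂ)), π f = 0 := by
    intro f
    refine norm_le_zero_iff.1 (le_of_forall_pos_le_add fun ε hε => ?_)
    obtain ⟨g, hg, hfg⟩ := aux_dense f ε hε
    have h1 : π g = 0 := by
      ext ψ
      exact aux_compact π U hU hpos hcov g hg ψ
    have h2 : π f = π (f - g) := by rw [map_sub, h1, sub_zero]
    rw [h2, zero_add]
    exact (NonUnitalStarAlgHom.norm_apply_le π _).trans hfg
  have hbot : Submodule.span ℂ {v : H | ∃ (f : C₀(ℝ, ℂ)) (ψ : H), v = π f ψ} = ⊥ := by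
    rw [Submodule.span_eq_bot]
    rintro x ⟨f, ψ, rfl⟩
    simp [hz f]
  rw [hbot] at hnd
  intro v
  have hv := hnd v
  simpa using hv
end
end
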